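/- Fix an integer n ≥ 2 and a splitting type r, and set C_{k,r} = δ(r)^{(k−1)/2}·k!/(2^{(k−1)/2}((k−1)/2)!) for odd k. There exist constants c, C > 0 depending only on n and r such that for all z ≥ 3, N > 2 and all odd natural numbers k with k ≤ c·min( z/(log z · log log z), log N/log z ), one has | 𝔼_N( (Σ_{p ≤ z} Y_p(f))^k ) | ≤ C·( C_{k,r}·π(z)^{k/2}·k·(log log z)/π(z)^{1/2} + z^{k(n+1)}/(N·log z) ). -/

import Mathlib

/-!
Arithmetic statistics of families of integer `S_n`-polynomials (I. Viglino).

`𝒫_{n,N}` is the family of monic integer polynomials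
`f(X) = X^n + a_{n-1}X^{n-1} + ⋯ + a_0` with `|a_i| ≤ N`, identified with their
coefficient vectors `a : Fin n → ℤ`, and `𝒫⁰_{n,N} ⊆ 𝒫_{n,N}` is the subfamily of
`f` whose splitting field over `ℚ` has Galois group isomorphic to `S_n`.
-/

open Polynomial Finset Filter

attribute [local instance] Classical.propDecidable

noncomputable section

/-- The monic integer polynomial `X^n + a_{n-1}X^{n-1} + ⋯ + a_0`. -/
def intPoly (n : ℕ) (a : Fin n → ℤ) : Polynomial ℤ :=
  Polynomial.X ^ n + ∑ i : Fin n, Polynomial.C (a i) * Polynomial.X ^ (i : ℕ)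

/-- The same polynomial viewed over `ℚ`. -/
def ratPoly (n : ℕ) (a : Fin n → ℤ) : Polynomial ℚ :=
  (intPoly n a).map (Int.castRingHom ℚ)

/-- Coefficient vectors with entries in `{-N, …, N}`: the family `𝒫_{n,N}`. -/
def coeffBox (n N : ℕ) : Finset (Fin n → ℤ) :=
  Fintype.piFinset fun _ => Finset.Icc (-(N : ℤ)) (N : ℤ)

/-- `f` is an `S_n`-polynomial: the Galois group of its splitting field `K_f` over `ℚ`
is isomorphic to the symmetric group on `n` letters. -/
def IsSnPoly (n : ℕ) (a : Fin n → ℤ) : Prop :=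
  Nonempty ((ratPoly n a).Gal ≃* Equiv.Perm (Fin n))

/-- The family `𝒫⁰_{n,N}` of `S_n`-polynomials, as a finset of coefficient vectors. -/
def P0 (n N : ℕ) : Finset (Fin n → ℤ) :=
  (coeffBox n N).filter fun a => IsSnPoly n a

/-- `ℙ_N`, the uniform probability of an event in `𝒫⁰_{n,N}`. -/
def probN (n N : ℕ) (E : (Fin n → ℤ) → Prop) : ℝ :=
  (((P0 n N).filter E).card : ℝ) / ((P0 n N).card : ℝ)

/-- `𝔼_N`, the expectation of a real random variable on `𝒫⁰_{n,N}`. -/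
def expN (n N : ℕ) (F : (Fin n → ℤ) → ℝ) : ℝ :=
  (∑ a ∈ P0 n N, F a) / ((P0 n N).card : ℝ)

/-- `π(x)`, the number of rational primes `≤ x`. -/
def primePi (x : ℝ) : ℕ :=
  ((Finset.range (⌊x⌋₊ + 1)).filter Nat.Prime).card

/-- `g ∈ 𝔽_p[X]` has splitting type `r = (r_1, …, r_n)` — encoded by `r : Fin n → ℕ` where
`r i` is `r_{i+1}`, the number of factors of degree `i+1` —, i.e. `g` is a product of
distinct monic irreducible polynomials with exactly `r i` monic irreducible factors of
degree `i+1` for each `i`. -/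
def SplitTypeOf {p : ℕ} (g : Polynomial (ZMod p)) {n : ℕ} (r : Fin n → ℕ) : Prop :=
  Squarefree g ∧ ∀ i : Fin n,
    Nat.card {h : Polynomial (ZMod p) // h.Monic ∧ Irreducible h ∧
      h.natDegree = (i : ℕ) + 1 ∧ h ∣ g} = r i

/-- `f` has splitting type `r` modulo `p`. -/
def HasSplitType (n : ℕ) (r : Fin n → ℕ) (a : Fin n → ℤ) (p : ℕ) : Prop :=
  SplitTypeOf ((intPoly n a).map (Int.castRingHom (ZMod p))) r

/-- `π_{f,r}(x)`: the number of primes `p ≤ x` such that `f` has splitting type `r` mod `p`. -/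
def countSplit (n : ℕ) (r : Fin n → ℕ) (a : Fin n → ℤ) (x : ℝ) : ℕ :=
  ((Finset.range (⌊x⌋₊ + 1)).filter fun p => p.Prime ∧ HasSplitType n r a p).card

/-- `δ(r) = ∏_{i=1}^n 1/(i^{r_i}·r_i!)`. -/
def splitDelta (n : ℕ) (r : Fin n → ℕ) : ℝ :=
  ∏ i : Fin n, (1 : ℝ) / ((((i : ℕ) + 1) ^ (r i) * Nat.factorial (r i) : ℕ) : ℝ)

/-- `r_i` as a function of the index `i ≥ 1` (so `rget n r 1 = r_1`, etc.). -/
def rget (n : ℕ) (r : Fin n → ℕ) (i : ℕ) : ℕ :=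
  if h : i - 1 < n then r ⟨i - 1, h⟩ else 0

/-- `C_r = δ(r)·r_2(r_2−1)(r_1+1)(r_1+2)/(2^{r_2+1}·r_1!·r_2!)`. -/
def splitCr (n : ℕ) (r : Fin n → ℕ) : ℝ :=
  splitDelta n r *
    ((rget n r 2 : ℝ) * ((rget n r 2 : ℝ) - 1) *
      ((rget n r 1 : ℝ) + 1) * ((rget n r 1 : ℝ) + 2)) /
    ((2 : ℝ) ^ (rget n r 2 + 1) * (Nat.factorial (rget n r 1) : ℝ) *
      (Nat.factorial (rget n r 2) : ℝ))

/-- `|𝒳_{n,r,p}|`: the number of monic degree-`n` polynomials over `𝔽_p` that are products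
of distinct monic irreducible polynomials with exactly `r_i` factors of degree `i`. -/
def Xcard (n : ℕ) (r : Fin n → ℕ) (p : ℕ) : ℕ :=
  Nat.card {g : Polynomial (ZMod p) // g.Monic ∧ g.natDegree = n ∧ SplitTypeOf g r}

/-- `Y_p(f) = 𝟙_p(f) − |𝒳_{n,r,p}|/pⁿ`. -/
def Yp (n : ℕ) (r : Fin n → ℕ) (p : ℕ) (a : Fin n → ℤ) : ℝ :=
  (if HasSplitType n r a p then (1 : ℝ) else 0) - (Xcard n r p : ℝ) / (p : ℝ) ^ n

/-- `C_{k,r} = δ(r)^{(k−1)/2}·k!/(2^{(k−1)/2}((k−1)/2)!)` for odd `k`. -/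
def CkrOdd (n : ℕ) (r : Fin n → ℕ) (k : ℕ) : ℝ :=
  splitDelta n r ^ ((k - 1) / 2) * (Nat.factorial k : ℝ) /
    ((2 : ℝ) ^ ((k - 1) / 2) * (Nat.factorial ((k - 1) / 2) : ℝ))

/-- Reduction of an integer vector modulo `m`. -/
def redVec {n : ℕ} (m : ℕ) (a : Fin n → ℤ) : Fin n → ZMod m := fun j => (a j : ZMod m)

lemma abs_prod_add_sub_pow_le {ι : Type*} (s : Finset ι) (x : ℝ) (hx : 0 ≤ x) (θ : ι → ℝ)
    (hθ : ∀ i ∈ s, |θ i| ≤ 1) :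
    |∏ i ∈ s, (x + θ i) - x ^ s.card| ≤ (x + 1) ^ s.card - x ^ s.card := by
  induction s using Finset.induction_on with
  | empty => simp
  | insert i s hi ih =>
    rw [Finset.prod_insert hi, Finset.card_insert_of_notMem hi]
    have ih' := ih fun j hj => hθ j (Finset.mem_insert_of_mem hj)
    have h1 := hθ i (Finset.mem_insert_self i s)
    have hx1 : |x + θ i| ≤ x + 1 := by
      rw [abs_le] at h1 ⊢; constructor <;> linarith [h1.1, h1.2]
    have e : (x + θ i) * ∏ j ∈ s, (x + θ j) - x ^ (s.card + 1)
        = (x + θ i) * (∏ j ∈ s, (x + θ j) - x ^ s.card) + θ i * x ^ s.card := by ring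
    rw [e]
    calc _ ≤ |(x + θ i) * (∏ j ∈ s, (x + θ j) - x ^ s.card)| + |θ i * x ^ s.card| :=
          abs_add_le _ _
      _ = |x + θ i| * |∏ j ∈ s, (x + θ j) - x ^ s.card| + |θ i| * x ^ s.card := by
          rw [abs_mul, abs_mul, abs_of_nonneg (pow_nonneg hx s.card)]
      _ ≤ (x + 1) * ((x + 1) ^ s.card - x ^ s.card) + 1 * x ^ s.card := by
          gcongr
      _ = _ := by ring

lemma card_Icc_filter_modEq (N q : ℕ) (hq : 0 < q) (b : ℤ) :
    |(((Finset.Icc (-(N : ℤ)) N).filter fun x => x ≡ b [ZMOD q]).card : ℝ)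
      - (2 * N + 1) / q| ≤ 1 := by
  have hI : Finset.Icc (-(N : ℤ)) N = Finset.Ioc (-(N : ℤ) - 1) N := by
    ext x; simp only [Finset.mem_Icc, Finset.mem_Ioc]; omega
  have hq' : (0 : ℤ) < q := by exact_mod_cast hq
  have h := Int.Ioc_filter_modEq_card (-(N : ℤ) - 1) N hq' b
  have hqR : (0 : ℝ) < q := by exact_mod_cast hq
  have h2 : ((((Finset.Icc (-(N : ℤ)) N).filter fun x => x ≡ b [ZMOD q]).card : ℤ) : ℝ)
      = ((max (⌊((N : ℤ) - b : ℚ) / (q : ℤ)⌋ -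
          ⌊((-(N : ℤ) - 1 : ℤ) - b : ℚ) / (q : ℤ)⌋) 0 : ℤ) : ℝ) := by
    rw [hI, ← h]
  have hc : ((((Finset.Icc (-(N : ℤ)) N).filter fun x => x ≡ b [ZMOD q]).card : ℤ) : ℝ)
    = (((Finset.Icc (-(N : ℤ)) N).filter fun x => x ≡ b [ZMOD q]).card : ℝ) := by simp
  rw [← hc, h2]
  set A : ℚ := ((N : ℤ) - b : ℚ) / (q : ℤ) with hA
  set B : ℚ := ((-(N : ℤ) - 1 : ℤ) - b : ℚ) / (q : ℤ) with hB
  have hqQ : (0 : ℚ) < q := by exact_mod_cast hq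
  have hAB : A - B = (2 * N + 1) / q := by
    rw [hA, hB]; push_cast; field_simp; ring
  have hpos : 0 ≤ A - B := by rw [hAB]; positivity
  have hmono : ⌊B⌋ ≤ ⌊A⌋ := Int.floor_mono (by linarith)
  rw [max_eq_left (by omega)]
  have e1 := Int.floor_le A
  have e2 := Int.lt_floor_add_one A
  have e3 := Int.floor_le B
  have e4 := Int.lt_floor_add_one B
  have key : |(((⌊A⌋ - ⌊B⌋ : ℤ) : ℚ)) - (2 * N + 1) / q| ≤ 1 := by
    rw [← hAB, abs_le]; push_cast; constructor <;> linarith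
  have key' := (Rat.cast_le (K := ℝ)).mpr key
  push_cast at key' ⊢
  exact key'

section Box

variable {ι : Type*} [Fintype ι] (m : ι → ℕ) [∀ i, NeZero (m i)]

lemma card_Icc_filter_residues (hm : Pairwise (Function.onFun Nat.Coprime m)) (N : ℕ)
    (w : ∀ i, ZMod (m i)) :
    |(((Finset.Icc (-(N : ℤ)) N).filter fun x => ∀ i, (x : ZMod (m i)) = w i).card : ℝ)
      - (2 * N + 1) / (∏ i, m i : ℕ)| ≤ 1 := by
  have hq : 0 < ∏ i, m i := Finset.prod_pos fun i _ => Nat.pos_of_ne_zero (NeZero.ne _)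
  obtain ⟨b, hb⟩ := (ZMod.prodEquivPi m hm).surjective w
  obtain ⟨b', rfl⟩ := ZMod.intCast_surjective b
  have hfil : ((Finset.Icc (-(N : ℤ)) N).filter fun x => ∀ i, (x : ZMod (m i)) = w i)
      = (Finset.Icc (-(N : ℤ)) N).filter fun x => x ≡ b' [ZMOD (∏ i, m i : ℕ)] := by
    refine Finset.filter_congr fun x _ => ?_
    rw [← ZMod.intCast_eq_intCast_iff, ← (ZMod.prodEquivPi m hm).injective.eq_iff, hb,
      map_intCast, funext_iff]
    simp
  rw [hfil]
  exact card_Icc_filter_modEq N _ hq b'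

lemma card_coeffBox_filter_residues (hm : Pairwise (Function.onFun Nat.Coprime m)) (n N : ℕ)
    (v : ∀ i, Fin n → ZMod (m i)) :
    |(((coeffBox n N).filter fun a => ∀ i, redVec (m i) a = v i).card : ℝ)
      - ((2 * N + 1) / (∏ i, m i : ℕ)) ^ n|
      ≤ ((2 * N + 1) / (∏ i, m i : ℕ) + 1 : ℝ) ^ n - ((2 * N + 1) / (∏ i, m i : ℕ)) ^ n := by
  have hfil : ((coeffBox n N).filter fun a => ∀ i, redVec (m i) a = v i)
      = Fintype.piFinset fun j : Fin n =>
        (Finset.Icc (-(N : ℤ)) N).filter fun x => ∀ i, (x : ZMod (m i)) = v i j := by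
    ext a
    simp only [coeffBox, Finset.mem_filter, Fintype.mem_piFinset, redVec, funext_iff]
    constructor
    · rintro ⟨h1, h2⟩ j; exact ⟨h1 j, fun i => h2 i j⟩
    · intro h; exact ⟨fun j => (h j).1, fun i j => (h j).2 i⟩
  rw [hfil, Fintype.card_piFinset, Nat.cast_prod]
  have h := abs_prod_add_sub_pow_le (Finset.univ : Finset (Fin n))
    ((2 * N + 1) / (∏ i, m i : ℕ)) (by positivity)
    (fun j => (((Finset.Icc (-(N : ℤ)) N).filter fun x => ∀ i, (x : ZMod (m i)) = v i j).card : ℝ)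
      - (2 * N + 1) / (∏ i, m i : ℕ)) (fun j _ => card_Icc_filter_residues m hm N _)
  simpa using h

/-- Equidistribution of the coefficient box modulo pairwise coprime moduli. -/
lemma abs_sum_coeffBox_prod_sub_le (hm : Pairwise (Function.onFun Nat.Coprime m)) (n N : ℕ)
    (g : ∀ i, (Fin n → ZMod (m i)) → ℝ) (hg : ∀ i v, |g i v| ≤ 1) :
    |∑ a ∈ coeffBox n N, ∏ i, g i (redVec (m i) a)
      - (2 * N + 1 : ℝ) ^ n * ∏ i, ((∑ v, g i v) / (m i : ℝ) ^ n)|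
      ≤ (2 * N + 1 + (∏ i, m i : ℕ) : ℝ) ^ n - (2 * N + 1 : ℝ) ^ n := by
  set q : ℕ := ∏ i, m i with hqdef
  have hq : 0 < q := Finset.prod_pos fun i _ => Nat.pos_of_ne_zero (NeZero.ne _)
  have hqR : (0 : ℝ) < q := by exact_mod_cast hq
  have e1 : ∑ a ∈ coeffBox n N, ∏ i, g i (redVec (m i) a)
      = ∑ v : (∀ i, Fin n → ZMod (m i)), (((coeffBox n N).filter fun a =>
          ∀ i, redVec (m i) a = v i).card : ℝ) * ∏ i, g i (v i) := by
    rw [← Finset.sum_fiberwise (coeffBox n N) (fun a i => redVec (m i) a)]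
    refine Finset.sum_congr rfl fun v _ => ?_
    rw [← nsmul_eq_mul, ← Finset.sum_const]
    refine Finset.sum_congr (Finset.filter_congr fun a _ => funext_iff) fun a ha => ?_
    rw [Finset.mem_filter] at ha
    exact Finset.prod_congr rfl fun i _ => by rw [ha.2 i]
  have e2 : (2 * N + 1 : ℝ) ^ n * ∏ i, ((∑ v, g i v) / (m i : ℝ) ^ n)
      = ∑ v : (∀ i, Fin n → ZMod (m i)), ((2 * N + 1) / q : ℝ) ^ n * ∏ i, g i (v i) := by
    rw [Finset.prod_div_distrib, Finset.prod_univ_sum, Fintype.piFinset_univ, ← Finset.mul_sum,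
      Finset.prod_pow, div_pow, hqdef]
    push_cast
    ring
  have hcard : (Fintype.card (∀ i, Fin n → ZMod (m i)) : ℝ) = (q : ℝ) ^ n := by
    rw [Fintype.card_pi]
    simp only [Fintype.card_pi, ZMod.card, Finset.prod_const, Finset.card_univ, Fintype.card_fin]
    rw [Finset.prod_pow, hqdef]; push_cast; rfl
  rw [e1, e2, ← Finset.sum_sub_distrib]
  calc _ ≤ ∑ v : (∀ i, Fin n → ZMod (m i)),
        (((2 * N + 1) / q + 1 : ℝ) ^ n - ((2 * N + 1) / q : ℝ) ^ n) := by
        refine (Finset.abs_sum_le_sum_abs _ _).trans (Finset.sum_le_sum fun v _ => ?_)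
        rw [← sub_mul, abs_mul]
        have hp : |∏ i, g i (v i)| ≤ 1 := by
          rw [Finset.abs_prod]
          exact Finset.prod_le_one (fun _ _ => abs_nonneg _) fun i _ => hg i _
        have h := card_coeffBox_filter_residues m hm n N v
        exact (mul_le_of_le_one_right (abs_nonneg _) hp).trans h
    _ = _ := by
        rw [Finset.sum_const, Finset.card_univ, nsmul_eq_mul, hcard, mul_sub, ← mul_pow, ← mul_pow]
        congr 2 <;> field_simp

end Box

section Moments

variable {ι : Type*} [Fintype ι]

lemma card_filter_ne_zero_le_sum (j : ι → ℕ) :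
    (Finset.univ.filter fun i => j i ≠ 0).card ≤ ∑ i, j i := by
  rw [Finset.card_eq_sum_ones, Finset.sum_filter]
  exact Finset.sum_le_sum fun i _ => by split_ifs <;> omega

/-- Comparison of box moments with the moments of independent residues. -/
lemma abs_sum_coeffBox_pow_sub_le (m : ι → ℕ) [∀ i, NeZero (m i)]
    (hm : Pairwise (Function.onFun Nat.Coprime m)) (n N k Z : ℕ) (hZ : 1 ≤ Z)
    (hmZ : ∀ i, m i ≤ Z) (g : ∀ i, (Fin n → ZMod (m i)) → ℝ) (hg : ∀ i v, |g i v| ≤ 1) :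
    |∑ a ∈ coeffBox n N, (∑ i, g i (redVec (m i) a)) ^ k
      - (2 * N + 1 : ℝ) ^ n * ∑ j ∈ Finset.piAntidiag (Finset.univ : Finset ι) k,
        (Nat.multinomial Finset.univ j : ℝ) * ∏ i, ((∑ v, g i v ^ j i) / (m i : ℝ) ^ n)|
      ≤ (Fintype.card ι : ℝ) ^ k * ((2 * N + 1 + (Z : ℝ) ^ k) ^ n - (2 * N + 1 : ℝ) ^ n) := by
  have e1 : ∑ a ∈ coeffBox n N, (∑ i, g i (redVec (m i) a)) ^ k
      = ∑ j ∈ Finset.piAntidiag (Finset.univ : Finset ι) k,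
        (Nat.multinomial Finset.univ j : ℝ) *
          ∑ a ∈ coeffBox n N, ∏ i, g i (redVec (m i) a) ^ j i := by
    simp_rw [Finset.sum_pow_eq_sum_piAntidiag, Finset.mul_sum]
    exact Finset.sum_comm
  have e2 : (Fintype.card ι : ℝ) ^ k
      = ∑ j ∈ Finset.piAntidiag (Finset.univ : Finset ι) k,
        (Nat.multinomial Finset.univ j : ℝ) := by
    have h := Finset.sum_pow_eq_sum_piAntidiag (Finset.univ : Finset ι) (fun _ => (1 : ℝ)) k
    simpa using h
  rw [e1, e2, Finset.mul_sum, ← Finset.sum_sub_distrib, Finset.sum_mul]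
  refine (Finset.abs_sum_le_sum_abs _ _).trans (Finset.sum_le_sum fun j hj => ?_)
  rw [Finset.mem_piAntidiag] at hj
  have e3 : ∀ A B : ℝ, (Nat.multinomial Finset.univ j : ℝ) * A - (2 * N + 1 : ℝ) ^ n *
      ((Nat.multinomial Finset.univ j : ℝ) * B)
      = (Nat.multinomial Finset.univ j : ℝ) * (A - (2 * N + 1 : ℝ) ^ n * B) := by
    intros; ring
  rw [e3, abs_mul, abs_of_nonneg (Nat.cast_nonneg _)]
  refine mul_le_mul_of_nonneg_left ?_ (Nat.cast_nonneg _)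
  have hsub : ∀ F : ι → ℝ, (∀ i, j i = 0 → F i = 1) →
      ∏ i, F i = ∏ i : {i // j i ≠ 0}, F i := by
    intro F hF
    rw [← Finset.prod_subtype (Finset.univ.filter fun i => j i ≠ 0) (by simp) F,
      Finset.prod_filter]
    exact Finset.prod_congr rfl fun i _ => by
      split_ifs with h
      · rfl
      · exact hF i (not_not.mp h)
  have h := abs_sum_coeffBox_prod_sub_le (fun i : {i // j i ≠ 0} => m i)
    (fun a b hab => hm fun h => hab (Subtype.ext h)) n N (fun i v => g i v ^ j i)
    (fun i v => by rw [abs_pow]; exact pow_le_one₀ (abs_nonneg _) (hg _ _))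
  rw [hsub (fun i => (∑ v, g i v ^ j i) / (m i : ℝ) ^ n)]
  · simp_rw [fun a => hsub (fun i => g i (redVec (m i) a) ^ j i) (fun i hi => by simp [hi])]
    refine h.trans ?_
    gcongr
    have hle : ∏ i : {i // j i ≠ 0}, m i ≤ Z ^ k := by
      calc _ ≤ ∏ i : {i // j i ≠ 0}, Z := Finset.prod_le_prod' fun i _ => hmZ i
        _ = Z ^ (Finset.univ.filter fun i => j i ≠ 0).card := by
            rw [Finset.prod_const, Finset.card_univ, Fintype.card_subtype]
        _ ≤ Z ^ k := Nat.pow_le_pow_right hZ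
            ((card_filter_ne_zero_le_sum j).trans hj.1.le)
    exact_mod_cast hle
  · intro i hi
    have : (m i : ℝ) ≠ 0 := by exact_mod_cast NeZero.ne (m i)
    simp [hi, this]

lemma exp_sub_one_sub_le {x : ℝ} (h0 : 0 ≤ x) (h1 : x ≤ 1) :
    Real.exp x - 1 - x ≤ x ^ 2 / 2 * (1 + x) := by
  have h := Real.exp_bound' h0 h1 (n := 3) (by norm_num)
  simp only [Finset.sum_range_succ, Finset.sum_range_zero, Nat.factorial] at h
  norm_num at h
  nlinarith [pow_nonneg h0 3]

/-- Bound for the multinomial sum of centred bounded moments. -/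
lemma abs_sum_multinomial_le (μ : ι → ℕ → ℝ) (k : ℕ) (hk : 1 ≤ k) (v t x : ℝ) (hv : 0 ≤ v)
    (ht : 0 < t) (ht1 : t ≤ 1) (hx : 0 < x) (h0 : ∀ i, μ i 0 = 1) (h1 : ∀ i, μ i 1 = 0)
    (h2 : ∀ i l, 2 ≤ l → |μ i l| ≤ v) :
    |∑ j ∈ Finset.piAntidiag (Finset.univ : Finset ι) k,
        (Nat.multinomial Finset.univ j : ℝ) * ∏ i, μ i (j i)|
      ≤ (t⁻¹) ^ (k / 2) * (k.factorial : ℝ) * (x⁻¹) ^ k *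
        Real.exp (Fintype.card ι * (t * v) * (Real.exp x - 1 - x)) := by
  set w : ℕ → ℝ := fun l => if l = 0 then 1 else if l = 1 then 0 else t * v with hw
  have hw0 : ∀ l, 0 ≤ w l := fun l => by
    simp only [hw]; split_ifs <;> positivity
  have hprod : ∀ j ∈ Finset.piAntidiag (Finset.univ : Finset ι) k,
      |∏ i, μ i (j i)| ≤ (t⁻¹) ^ (k / 2) * ∏ i, w (j i) := by
    intro j hj
    rw [Finset.mem_piAntidiag] at hj
    by_cases hex : ∃ i, j i = 1
    · obtain ⟨i, hi⟩ := hex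
      rw [Finset.prod_eq_zero (Finset.mem_univ i) (by rw [hi, h1]), abs_zero]
      exact mul_nonneg (by positivity) (Finset.prod_nonneg fun _ _ => hw0 _)
    · push Not at hex
      have hcard : (Finset.univ.filter fun i => j i ≠ 0).card ≤ k / 2 := by
        rw [Nat.le_div_iff_mul_le (by norm_num), ← hj.1, Finset.card_eq_sum_ones,
          Finset.sum_filter, Finset.sum_mul]
        refine Finset.sum_le_sum fun i _ => ?_
        have := hex i
        split_ifs <;> omega
      have hti : 1 ≤ t⁻¹ := (one_le_inv₀ ht).mpr ht1
      have hle : |∏ i, μ i (j i)|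
          ≤ ∏ i, ((if j i ≠ 0 then t⁻¹ else 1) * w (j i)) := by
        rw [Finset.abs_prod]
        refine Finset.prod_le_prod (fun _ _ => abs_nonneg _) fun i _ => ?_
        have h1i := hex i
        by_cases h0i : j i = 0
        · simp [h0i, h0, hw]
        · simp only [hw, h0i, h1i, if_false, ne_eq, not_false_eq_true, if_true]
          rw [← mul_assoc, inv_mul_cancel₀ ht.ne', one_mul]
          exact h2 i _ (by omega)
      refine hle.trans ?_
      rw [Finset.prod_mul_distrib, ← Finset.prod_filter, Finset.prod_const]
      exact mul_le_mul_of_nonneg_right (pow_le_pow_right₀ hti hcard)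
        (Finset.prod_nonneg fun _ _ => hw0 _)
  have hmult : ∀ j ∈ Finset.piAntidiag (Finset.univ : Finset ι) k,
      (Nat.multinomial Finset.univ j : ℝ) * ∏ i, w (j i)
        = k.factorial * (x⁻¹) ^ k * ∏ i, (w (j i) * (x ^ j i / (j i).factorial)) := by
    intro j hj
    rw [Finset.mem_piAntidiag] at hj
    have hs := Nat.multinomial_spec Finset.univ j
    rw [hj.1] at hs
    have hs' : (∏ i, ((j i).factorial : ℝ)) * (Nat.multinomial Finset.univ j : ℝ)
        = k.factorial := by exact_mod_cast hs
    have hf : (∏ i, ((j i).factorial : ℝ)) ≠ 0 :=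
      Finset.prod_ne_zero_iff.mpr fun i _ => by positivity
    rw [Finset.prod_mul_distrib, Finset.prod_div_distrib, Finset.prod_pow_eq_pow_sum, hj.1,
      ← hs', inv_pow]
    field_simp
  have hone : ∑ l ∈ Finset.range (k + 1), w l * (x ^ l / l.factorial)
      ≤ Real.exp (t * v * (Real.exp x - 1 - x)) := by
    obtain ⟨s, rfl⟩ : ∃ s, k = s + 1 := ⟨k - 1, by omega⟩
    have hexp := Real.sum_le_exp_of_nonneg hx.le (s + 2)
    rw [Finset.sum_range_succ', Finset.sum_range_succ'] at hexp ⊢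
    have hsum : ∑ l ∈ Finset.range s, w (l + 1 + 1) * (x ^ (l + 1 + 1) / (l + 1 + 1).factorial)
        = t * v * ∑ l ∈ Finset.range s, (x ^ (l + 1 + 1) / (l + 1 + 1).factorial) := by
      rw [Finset.mul_sum]
      exact Finset.sum_congr rfl fun l _ => by simp [hw]
    rw [hsum]
    have e0 : w 0 = 1 := by simp [hw]
    have e1 : w (0 + 1) = 0 := by simp [hw]
    rw [e0, e1]
    norm_num at hexp ⊢
    have hle : ∑ l ∈ Finset.range s, (x ^ (l + 1 + 1) / ((l + 1 + 1).factorial : ℝ))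
        ≤ Real.exp x - 1 - x := by linarith
    have := mul_le_mul_of_nonneg_left hle (by positivity : 0 ≤ t * v)
    linarith [Real.add_one_le_exp (t * v * (Real.exp x - 1 - x))]
  have hchern : ∑ j ∈ Finset.piAntidiag (Finset.univ : Finset ι) k,
      ∏ i, (w (j i) * (x ^ j i / (j i).factorial))
        ≤ Real.exp (Fintype.card ι * (t * v) * (Real.exp x - 1 - x)) := by
    have hsub : Finset.piAntidiag (Finset.univ : Finset ι) k
        ⊆ Fintype.piFinset fun _ => Finset.range (k + 1) := by
      intro j hj
      rw [Finset.mem_piAntidiag] at hj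
      rw [Fintype.mem_piFinset]
      intro i
      have := Finset.single_le_sum (fun i _ => Nat.zero_le (j i)) (Finset.mem_univ i)
      rw [Finset.mem_range, ← hj.1]
      exact Nat.lt_succ_of_le this
    calc _ ≤ ∑ j ∈ Fintype.piFinset fun _ : ι => Finset.range (k + 1),
          ∏ i, (w (j i) * (x ^ j i / (j i).factorial)) :=
          Finset.sum_le_sum_of_subset_of_nonneg hsub fun j _ _ =>
            Finset.prod_nonneg fun i _ => mul_nonneg (hw0 _) (by positivity)
      _ = ∏ _i : ι, ∑ l ∈ Finset.range (k + 1), w l * (x ^ l / l.factorial) :=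
          (Finset.prod_univ_sum (fun _ : ι => Finset.range (k + 1))
            (fun _ l => w l * (x ^ l / l.factorial))).symm
      _ ≤ ∏ _i : ι, Real.exp (t * v * (Real.exp x - 1 - x)) :=
          Finset.prod_le_prod (fun _ _ => Finset.sum_nonneg fun l _ =>
            mul_nonneg (hw0 _) (by positivity)) fun _ _ => hone
      _ = _ := by
          rw [Finset.prod_const, ← Real.exp_nat_mul, Finset.card_univ]; ring_nf
  calc _ ≤ ∑ j ∈ Finset.piAntidiag (Finset.univ : Finset ι) k,
        (t⁻¹) ^ (k / 2) * (k.factorial * (x⁻¹) ^ k *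
          ∏ i, (w (j i) * (x ^ j i / (j i).factorial))) := by
        refine (Finset.abs_sum_le_sum_abs _ _).trans (Finset.sum_le_sum fun j hj => ?_)
        rw [abs_mul, abs_of_nonneg (Nat.cast_nonneg _), ← hmult j hj]
        calc _ ≤ (Nat.multinomial Finset.univ j : ℝ) * ((t⁻¹) ^ (k / 2) * ∏ i, w (j i)) :=
              mul_le_mul_of_nonneg_left (hprod j hj) (Nat.cast_nonneg _)
          _ = _ := by ring
    _ = (t⁻¹) ^ (k / 2) * (k.factorial : ℝ) * (x⁻¹) ^ k *
        ∑ j ∈ Finset.piAntidiag (Finset.univ : Finset ι) k,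
          ∏ i, (w (j i) * (x ^ j i / (j i).factorial)) := by
        rw [← Finset.mul_sum, ← Finset.mul_sum]; ring
    _ ≤ _ := mul_le_mul_of_nonneg_left hchern (by positivity)

end Moments

/-- The monic polynomial of degree `n` with lower coefficients `v`. -/
def vecPoly {R : Type*} [CommRing R] {n : ℕ} (v : Fin n → R) : R[X] :=
  X ^ n + ∑ i : Fin n, C (v i) * X ^ (i : ℕ)

section VecPoly

variable {R : Type*} [CommRing R] {n : ℕ}

lemma degree_vecPoly_tail_lt (v : Fin n → R) :
    (∑ i : Fin n, C (v i) * X ^ (i : ℕ)).degree < (n : WithBot ℕ) := by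
  refine (Polynomial.degree_sum_le _ _).trans_lt ?_
  refine (Finset.sup_lt_iff (WithBot.bot_lt_coe n)).mpr fun i _ => ?_
  exact (degree_C_mul_X_pow_le _ _).trans_lt (WithBot.coe_lt_coe.mpr i.2)

lemma monic_vecPoly (v : Fin n → R) : (vecPoly v).Monic :=
  monic_X_pow_add (degree_vecPoly_tail_lt v)

lemma natDegree_vecPoly [Nontrivial R] (v : Fin n → R) : (vecPoly v).natDegree = n := by
  rw [natDegree_eq_of_degree_eq_some]
  rw [vecPoly, degree_add_eq_left_of_degree_lt] <;> rw [degree_X_pow]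
  exact degree_vecPoly_tail_lt v

lemma coeff_vecPoly (v : Fin n → R) (i : Fin n) : (vecPoly v).coeff i = v i := by
  rw [vecPoly, coeff_add, coeff_X_pow, if_neg i.2.ne, zero_add, finsetSum_coeff,
    Finset.sum_eq_single i]
  · simp
  · intro b _ hb
    rw [coeff_C_mul_X_pow, if_neg fun h => hb (Fin.ext h.symm)]
  · simp

lemma vecPoly_injective : Function.Injective (vecPoly : (Fin n → R) → R[X]) := fun v w h => by
  funext i; rw [← coeff_vecPoly v i, h, coeff_vecPoly]

lemma exists_vecPoly_eq {g : R[X]} (hg : g.Monic) (hn : g.natDegree = n) :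
    ∃ v : Fin n → R, vecPoly v = g := by
  refine ⟨fun i => g.coeff i, ?_⟩
  conv_rhs => rw [hg.as_sum, hn]
  rw [vecPoly, Fin.sum_univ_eq_sum_range (fun i => C (g.coeff i) * X ^ i)]

lemma map_vecPoly {S : Type*} [CommRing S] (φ : R →+* S) (v : Fin n → R) :
    (vecPoly v).map φ = vecPoly (fun i => φ (v i)) := by
  simp [vecPoly, Polynomial.map_sum]

lemma intPoly_map_zmod (p : ℕ) (a : Fin n → ℤ) :
    (intPoly n a).map (Int.castRingHom (ZMod p)) = vecPoly (redVec p a) :=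
  map_vecPoly (Int.castRingHom (ZMod p)) a

end VecPoly

section FiniteFieldCounts

variable (p : ℕ) [Fact p.Prime]

/-- Monic irreducible polynomials of degree `d` over `𝔽_p`. -/
def irredPolys (d : ℕ) : Finset (ZMod p)[X] :=
  (Finset.univ.image (vecPoly : (Fin d → ZMod p) → (ZMod p)[X])).filter Irreducible

variable {p}

lemma mem_irredPolys {d : ℕ} {h : (ZMod p)[X]} :
    h ∈ irredPolys p d ↔ h.Monic ∧ Irreducible h ∧ h.natDegree = d := by
  simp only [irredPolys, Finset.mem_filter, Finset.mem_image, Finset.mem_univ, true_and]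
  constructor
  · rintro ⟨⟨v, rfl⟩, hi⟩; exact ⟨monic_vecPoly v, hi, natDegree_vecPoly v⟩
  · rintro ⟨h1, h2, h3⟩; exact ⟨exists_vecPoly_eq h1 h3, h2⟩

lemma isCoprime_of_monic_irreducible {K : Type*} [Field K] {g h : K[X]} (hg : g.Monic)
    (hh : h.Monic) (ig : Irreducible g) (ih : Irreducible h) (hne : g ≠ h) : IsCoprime g h :=
  (Irreducible.coprime_iff_not_dvd ig).mpr fun hd =>
    hne (eq_of_monic_of_associated hg hh (ig.associated_of_dvd ih hd))

lemma mul_card_irredPolys_le (d : ℕ) (hd : d ≠ 0) : d * (irredPolys p d).card ≤ p ^ d := by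
  have hp : 1 < p := (Fact.out : p.Prime).one_lt
  have hne : (X ^ p ^ d - X : (ZMod p)[X]) ≠ 0 :=
    FiniteField.X_pow_card_pow_sub_X_ne_zero (ZMod p) hd hp
  have hdvd : ∏ h ∈ irredPolys p d, h ∣ (X ^ p ^ d - X : (ZMod p)[X]) := by
    refine Finset.prod_dvd_of_coprime (fun g hg h hh hgh => ?_) fun h hh => ?_
    · rw [Finset.mem_coe, mem_irredPolys] at hg hh
      exact isCoprime_of_monic_irreducible hg.1 hh.1 hg.2.1 hh.2.1 hgh
    · rw [mem_irredPolys] at hh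
      have := (hh.2.1.natDegree_dvd_iff_dvd_X_pow_card_pow_sub_X (n := d)).mp (by rw [hh.2.2])
      simpa using this
  have h := natDegree_le_of_dvd hdvd hne
  rw [FiniteField.X_pow_card_pow_sub_X_natDegree_eq (ZMod p) hd hp,
    natDegree_prod_of_monic _ _ fun h hh => (mem_irredPolys.mp hh).1,
    Finset.sum_congr rfl fun h hh => (mem_irredPolys.mp hh).2.2, Finset.sum_const,
    smul_eq_mul, mul_comm] at h
  exact h

lemma two_mul_geom_sum_le (p d : ℕ) (hp : 3 ≤ p) :
    2 * ∑ e ∈ Finset.range d, p ^ e ≤ p ^ d := by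
  induction d with
  | zero => simp
  | succ d ih =>
    rw [Finset.sum_range_succ, pow_succ]
    nlinarith [pow_pos (show 0 < p by omega) d]

lemma pow_le_two_mul_card_irredPolys (hp3 : 3 ≤ p) (d : ℕ) (hd : d ≠ 0) :
    p ^ d ≤ 2 * d * (irredPolys p d).card := by
  have : Fintype (GaloisField p d) := Fintype.ofFinite _
  have hcard : (Finset.univ : Finset (GaloisField p d)).card = p ^ d := by
    rw [Finset.card_univ, ← Nat.card_eq_fintype_card, GaloisField.card p d hd]
  have hmaps : Set.MapsTo (fun x : GaloisField p d => (minpoly (ZMod p) x).natDegree)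
      (Finset.univ : Finset (GaloisField p d)) (Finset.range (d + 1)) := by
    intro x _
    have := minpoly.natDegree_le (A := ZMod p) x
    rw [GaloisField.finrank p hd] at this
    simpa using Nat.lt_succ_of_le this
  have hfib : ∀ e, (Finset.univ.filter fun x : GaloisField p d =>
      (minpoly (ZMod p) x).natDegree = e).card ≤ e * (irredPolys p e).card := by
    intro e
    refine Finset.card_le_mul_card_image_of_maps_to (f := fun x => minpoly (ZMod p) x)
      (fun x hx => ?_) e fun h hh => ?_
    · rw [Finset.mem_filter] at hx
      have hintegral : IsIntegral (ZMod p) x := Algebra.IsIntegral.isIntegral x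
      exact mem_irredPolys.mpr ⟨minpoly.monic hintegral, minpoly.irreducible hintegral, hx.2⟩
    · rw [mem_irredPolys] at hh
      have hm : (h.map (algebraMap (ZMod p) (GaloisField p d))) ≠ 0 := (hh.1.map _).ne_zero
      calc _ ≤ (h.map (algebraMap (ZMod p) (GaloisField p d))).roots.toFinset.card := by
            refine Finset.card_le_card fun x hx => ?_
            rw [Finset.mem_filter] at hx
            rw [Multiset.mem_toFinset, mem_roots hm, IsRoot, eval_map_algebraMap, ← hx.2]
            exact minpoly.aeval _ _
        _ ≤ _ := Multiset.toFinset_card_le _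
        _ ≤ _ := card_roots' _
        _ = e := by rw [natDegree_map, hh.2.2]
  have h1 := Finset.card_eq_sum_card_fiberwise hmaps
  rw [hcard] at h1
  have h2 : p ^ d ≤ ∑ e ∈ Finset.range d, p ^ e + d * (irredPolys p d).card := by
    rw [h1, Finset.sum_range_succ]
    refine add_le_add (Finset.sum_le_sum fun e _ => (hfib e).trans ?_) (hfib d)
    rcases eq_or_ne e 0 with rfl | he
    · simp
    · exact mul_card_irredPolys_le e he
  have h3 := two_mul_geom_sum_le p d hp3
  nlinarith

lemma card_le_card_filter_vecPoly {n : ℕ} (S : Finset (ZMod p)[X]) (P : (ZMod p)[X] → Prop)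
    (hS : ∀ g ∈ S, g.Monic ∧ g.natDegree = n ∧ P g) :
    S.card ≤ (Finset.univ.filter fun v : Fin n → ZMod p => P (vecPoly v)).card := by
  rw [← Finset.card_image_of_injective _ (vecPoly_injective (R := ZMod p) (n := n))]
  refine Finset.card_le_card fun g hg => ?_
  obtain ⟨h1, h2, h3⟩ := hS g hg
  obtain ⟨v, rfl⟩ := exists_vecPoly_eq h1 h2
  exact Finset.mem_image_of_mem _ (Finset.mem_filter.mpr ⟨Finset.mem_univ _, h3⟩)

lemma natCard_irreducible_factors (g : (ZMod p)[X]) (d : ℕ) :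
    Nat.card {h : (ZMod p)[X] // h.Monic ∧ Irreducible h ∧ h.natDegree = d ∧ h ∣ g}
      = ((irredPolys p d).filter (· ∣ g)).card := by
  rw [← Nat.card_eq_finsetCard]
  refine Nat.card_congr (Equiv.subtypeEquivRight fun h => ?_)
  simp [mem_irredPolys, and_assoc]

lemma eq_of_squarefree_of_irreducible_dvd_iff {K : Type*} [Field K] {g h : K[X]} (hg : g.Monic)
    (hh : h.Monic) (sg : Squarefree g) (sh : Squarefree h)
    (hd : ∀ f : K[X], f.Monic → Irreducible f → (f ∣ g ↔ f ∣ h)) : g = h := by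
  have e : UniqueFactorizationMonoid.normalizedFactors g
      = UniqueFactorizationMonoid.normalizedFactors h := by
    refine (Multiset.Nodup.ext
      ((UniqueFactorizationMonoid.squarefree_iff_nodup_normalizedFactors hg.ne_zero).mp sg)
      ((UniqueFactorizationMonoid.squarefree_iff_nodup_normalizedFactors hh.ne_zero).mp sh)).mpr
      fun f => ?_
    rw [Polynomial.mem_normalizedFactors_iff hg.ne_zero,
      Polynomial.mem_normalizedFactors_iff hh.ne_zero]
    constructor
    · rintro ⟨h1, h2, h3⟩; exact ⟨h1, h2, (hd f h2 h1).mp h3⟩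
    · rintro ⟨h1, h2, h3⟩; exact ⟨h1, h2, (hd f h2 h1).mpr h3⟩
  refine eq_of_monic_of_associated hg hh ?_
  exact (UniqueFactorizationMonoid.prod_normalizedFactors hg.ne_zero).symm.trans
    (e ▸ UniqueFactorizationMonoid.prod_normalizedFactors hh.ne_zero)

lemma Xcard_eq_card_filter (n : ℕ) (r : Fin n → ℕ) :
    Xcard n r p =
      (Finset.univ.filter fun v : Fin n → ZMod p => SplitTypeOf (vecPoly v) r).card := by
  rw [← Fintype.card_subtype, ← Nat.card_eq_fintype_card, Xcard]
  refine (Nat.card_congr (Equiv.ofBijective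
    (fun v : {v : Fin n → ZMod p // SplitTypeOf (vecPoly v) r} =>
      (⟨vecPoly v.1, monic_vecPoly _, natDegree_vecPoly _, v.2⟩ :
        {g : (ZMod p)[X] // g.Monic ∧ g.natDegree = n ∧ SplitTypeOf g r})) ⟨?_, ?_⟩)).symm
  · intro v w h
    exact Subtype.ext (vecPoly_injective (congrArg Subtype.val h))
  · rintro ⟨g, h1, h2, h3⟩
    obtain ⟨v, rfl⟩ := exists_vecPoly_eq h1 h2
    exact ⟨⟨v, h3⟩, rfl⟩

lemma Xcard_le_prod_choose (n : ℕ) (r : Fin n → ℕ) :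
    Xcard n r p ≤ ∏ i : Fin n, (irredPolys p ((i : ℕ) + 1)).card.choose (r i) := by
  have hT : ∏ i : Fin n, (irredPolys p ((i : ℕ) + 1)).card.choose (r i)
      = (Fintype.piFinset fun i : Fin n =>
          (irredPolys p ((i : ℕ) + 1)).powersetCard (r i)).card := by
    rw [Fintype.card_piFinset]; simp [Finset.card_powersetCard]
  rw [hT, Xcard_eq_card_filter]
  refine Finset.card_le_card_of_injOn
    (fun v i => (irredPolys p ((i : ℕ) + 1)).filter (· ∣ vecPoly v)) ?_ ?_
  · intro v hv
    rw [Finset.mem_coe, Finset.mem_filter] at hv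
    rw [Finset.mem_coe, Fintype.mem_piFinset]
    intro i
    rw [Finset.mem_powersetCard]
    exact ⟨Finset.filter_subset _ _, by rw [← natCard_irreducible_factors, hv.2.2 i]⟩
  · intro v hv w hw hvw
    rw [Finset.mem_coe, Finset.mem_filter] at hv hw
    refine vecPoly_injective (eq_of_squarefree_of_irreducible_dvd_iff (monic_vecPoly v)
      (monic_vecPoly w) hv.2.1 hw.2.1 ?_)
    have key : ∀ v w : Fin n → ZMod p,
        (∀ i : Fin n, (irredPolys p ((i : ℕ) + 1)).filter (· ∣ vecPoly v)
          = (irredPolys p ((i : ℕ) + 1)).filter (· ∣ vecPoly w)) →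
        ∀ f : (ZMod p)[X], f.Monic → Irreducible f → f ∣ vecPoly v → f ∣ vecPoly w := by
      intro v w h f h1 h2 h3
      have hpos := h2.natDegree_pos
      have hle := natDegree_le_of_dvd h3 (monic_vecPoly v).ne_zero
      rw [natDegree_vecPoly] at hle
      have hi := h ⟨f.natDegree - 1, by omega⟩
      have hmem : f ∈ (irredPolys p (f.natDegree - 1 + 1)).filter (· ∣ vecPoly v) :=
        Finset.mem_filter.mpr ⟨mem_irredPolys.mpr ⟨h1, h2, by omega⟩, h3⟩
      rw [hi] at hmem
      exact (Finset.mem_filter.mp hmem).2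
    exact fun f h1 h2 => ⟨key v w (congrFun hvw) f h1 h2, key w v (congrFun hvw.symm) f h1 h2⟩

lemma Xcard_div_pow_le_splitDelta (n : ℕ) (r : Fin n → ℕ)
    (hr : ∑ i : Fin n, ((i : ℕ) + 1) * r i = n) :
    (Xcard n r p : ℝ) / (p : ℝ) ^ n ≤ splitDelta n r := by
  have hp : (0 : ℝ) < p := by exact_mod_cast (Fact.out : p.Prime).pos
  rw [div_le_iff₀ (pow_pos hp n)]
  have h1 : (Xcard n r p : ℝ) ≤ ∏ i : Fin n,
      ((irredPolys p ((i : ℕ) + 1)).card.choose (r i) : ℝ) := by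
    exact_mod_cast Xcard_le_prod_choose n r
  have h2 : (p : ℝ) ^ n = ∏ i : Fin n, (p : ℝ) ^ (((i : ℕ) + 1) * r i) := by
    rw [Finset.prod_pow_eq_pow_sum, hr]
  rw [h2, splitDelta, ← Finset.prod_mul_distrib]
  refine h1.trans (Finset.prod_le_prod (fun _ _ => by positivity) fun i _ => ?_)
  refine (Nat.choose_le_pow_div (α := ℝ) (r i) _).trans ?_
  have h3 : (((irredPolys p ((i : ℕ) + 1)).card : ℝ)) ≤
      (p : ℝ) ^ ((i : ℕ) + 1) / ((i : ℕ) + 1) := by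
    rw [le_div_iff₀ (by positivity), mul_comm]
    exact_mod_cast mul_card_irredPolys_le (p := p) ((i : ℕ) + 1) (by omega)
  calc _ ≤ ((p : ℝ) ^ ((i : ℕ) + 1) / ((i : ℕ) + 1)) ^ (r i) / ((r i).factorial : ℝ) := by gcongr
    _ = _ := by
      push_cast
      rw [div_pow, pow_mul]
      field_simp

end FiniteFieldCounts

/-- `g` is a linear factor times a coprime monic irreducible polynomial. -/
def LinearTimesIrred {K : Type*} [Field K] (g : K[X]) : Prop :=
  ∃ a h, g = (X - C a) * h ∧ h.Monic ∧ Irreducible h ∧ h.eval a ≠ 0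

/-- `g` is a monic irreducible quadratic times distinct linear factors. -/
def QuadTimesLinears {K : Type*} [Field K] (g : K[X]) : Prop :=
  ∃ (A : Finset K) (q : K[X]), g = q * ∏ a ∈ A, (X - C a) ∧ q.Monic ∧ Irreducible q ∧
    q.natDegree = 2

section Densities

variable {p : ℕ} [Fact p.Prime]

lemma card_irreducible_ge (hp : 3 ≤ p) {n : ℕ} (hn : n ≠ 0) :
    p ^ n ≤ 2 * n * (Finset.univ.filter fun v : Fin n → ZMod p => Irreducible (vecPoly v)).card :=
  (pow_le_two_mul_card_irredPolys hp n hn).trans <| Nat.mul_le_mul_left _ <|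
    card_le_card_filter_vecPoly _ _ fun g hg => by
      rw [mem_irredPolys] at hg; exact ⟨hg.1, hg.2.2, hg.2.1⟩

lemma card_eval_eq_zero_le_one {h : (ZMod p)[X]} (hm : h.Monic) (hi : Irreducible h) :
    (Finset.univ.filter fun a : ZMod p => h.eval a = 0).card ≤ 1 := by
  rw [Finset.card_le_one]
  have key : ∀ a, h.eval a = 0 → h = X - C a := fun a ha =>
    (eq_of_monic_of_associated (monic_X_sub_C a) hm
      ((irreducible_X_sub_C a).associated_of_dvd hi (dvd_iff_isRoot.mpr ha))).symm
  intro a ha b hb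
  rw [Finset.mem_filter] at ha hb
  have h2 := (key a ha.2).symm.trans (key b hb.2)
  exact C_injective (by linear_combination -h2)

lemma card_linearTimesIrred_ge (hp : 3 ≤ p) {n : ℕ} (hn : 2 ≤ n) :
    p ^ n ≤ 4 * n * n *
      (Finset.univ.filter fun v : Fin n → ZMod p => LinearTimesIrred (vecPoly v)).card := by
  set I := irredPolys p (n - 1) with hI
  set S : Finset ((ZMod p)[X] × ZMod p) :=
    (I ×ˢ Finset.univ).filter fun x => x.1.eval x.2 ≠ 0 with hS
  set F : (ZMod p)[X] × ZMod p → (ZMod p)[X] := fun x => (X - C x.2) * x.1 with hF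
  have hScard : I.card * (p - 1) ≤ S.card := by
    rw [hS, Finset.card_filter, Finset.sum_product, ← smul_eq_mul, ← Finset.sum_const]
    refine Finset.sum_le_sum fun h hh => ?_
    rw [← Finset.card_filter]
    have h1 := card_eval_eq_zero_le_one (mem_irredPolys.mp hh).1 (mem_irredPolys.mp hh).2.1
    have h2 := Finset.card_filter_add_card_filter_not (s := (Finset.univ : Finset (ZMod p)))
      (fun a => h.eval a = 0)
    rw [Finset.card_univ, ZMod.card] at h2
    simp only [ne_eq]
    omega
  have hfib : ∀ g ∈ S.image F, (S.filter fun x => F x = g).card ≤ n := by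
    intro g hg
    obtain ⟨x, hx, rfl⟩ := Finset.mem_image.mp hg
    rw [hS, Finset.mem_filter, Finset.mem_product, mem_irredPolys] at hx
    have hg0 : F x ≠ 0 := mul_ne_zero (X_sub_C_ne_zero _) hx.1.1.1.ne_zero
    calc _ ≤ ((F x).roots.toFinset).card := by
          refine Finset.card_le_card_of_injOn Prod.snd (fun y hy => ?_) fun y hy z hz hyz => ?_
          · rw [Finset.mem_coe, Finset.mem_filter] at hy
            rw [Finset.mem_coe, Multiset.mem_toFinset, mem_roots hg0, ← hy.2]
            simp [hF]
          · rw [Finset.mem_coe, Finset.mem_filter] at hy hz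
            have h := hy.2.trans hz.2.symm
            simp only [hF, hyz] at h
            exact Prod.ext (mul_left_cancel₀ (X_sub_C_ne_zero _) h) hyz
      _ ≤ _ := Multiset.toFinset_card_le _
      _ ≤ _ := card_roots' _
      _ = n := by
          simp only [hF]
          rw [(monic_X_sub_C _).natDegree_mul hx.1.1.1, natDegree_X_sub_C, hx.1.1.2.2]
          omega
  have h1 := Finset.card_le_mul_card_image S n hfib
  have h2 : (S.image F).card ≤ (Finset.univ.filter fun v : Fin n → ZMod p =>
      LinearTimesIrred (vecPoly v)).card := by
    refine card_le_card_filter_vecPoly _ _ fun g hg => ?_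
    obtain ⟨x, hx, rfl⟩ := Finset.mem_image.mp hg
    rw [hS, Finset.mem_filter, Finset.mem_product, mem_irredPolys] at hx
    refine ⟨(monic_X_sub_C _).mul hx.1.1.1, ?_, x.2, x.1, rfl, hx.1.1.1, hx.1.1.2.1, hx.2⟩
    simp only [hF]
    rw [(monic_X_sub_C _).natDegree_mul hx.1.1.1, natDegree_X_sub_C, hx.1.1.2.2]
    omega
  have h3 := pow_le_two_mul_card_irredPolys hp (n - 1) (by omega)
  have h4 : p ≤ 2 * (p - 1) := by omega
  calc p ^ n = p ^ (n - 1) * p := by rw [← pow_succ]; congr 1; omega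
    _ ≤ (2 * (n - 1) * I.card) * (2 * (p - 1)) := Nat.mul_le_mul h3 h4
    _ = 4 * (n - 1) * (I.card * (p - 1)) := by ring
    _ ≤ 4 * n * (n * (S.image F).card) :=
        Nat.mul_le_mul (by omega) (hScard.trans h1)
    _ ≤ 4 * n * (n * (Finset.univ.filter fun v : Fin n → ZMod p =>
      LinearTimesIrred (vecPoly v)).card) := by gcongr
    _ = _ := by ring

lemma pow_le_mul_choose (p k : ℕ) (hp : 2 * k ≤ p) :
    p ^ k ≤ 2 ^ k * k.factorial * p.choose k := by
  calc p ^ k ≤ (2 * (p + 1 - k)) ^ k := Nat.pow_le_pow_left (by omega) k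
    _ = 2 ^ k * (p + 1 - k) ^ k := mul_pow _ _ _
    _ ≤ 2 ^ k * p.descFactorial k := Nat.mul_le_mul_left _ (Nat.pow_sub_le_descFactorial p k)
    _ = _ := by rw [Nat.descFactorial_eq_factorial_mul_choose]; ring

lemma card_quadTimesLinears_ge (hp : 3 ≤ p) {n : ℕ} (hn : 2 ≤ n) (hpn : 2 * n ≤ p) :
    p ^ n ≤ 2 ^ n * (n - 2).factorial *
      (Finset.univ.filter fun v : Fin n → ZMod p => QuadTimesLinears (vecPoly v)).card := by
  set I := irredPolys p 2 with hI
  set S : Finset (Finset (ZMod p) × (ZMod p)[X]) :=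
    (Finset.univ.powersetCard (n - 2)) ×ˢ I with hS
  set F : Finset (ZMod p) × (ZMod p)[X] → (ZMod p)[X] :=
    fun x => x.2 * ∏ a ∈ x.1, (X - C a) with hF
  have hmP : ∀ A : Finset (ZMod p), (∏ a ∈ A, (X - C a)).Monic := fun A =>
    monic_prod_of_monic _ _ fun a _ => monic_X_sub_C a
  have hinj : Set.InjOn F S := by
    have hroots : ∀ x ∈ S, (F x).roots = x.1.val := by
      intro x hx
      rw [hS, Finset.mem_product, mem_irredPolys] at hx
      have hq : x.2.roots = 0 := by
        rw [Multiset.eq_zero_iff_forall_notMem]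
        intro a ha
        rw [mem_roots hx.2.1.ne_zero] at ha
        have h1 := degree_eq_one_of_irreducible_of_root hx.2.2.1 ha
        have h2 := natDegree_eq_of_degree_eq_some h1
        have h3 := hx.2.2.2
        rw [h2] at h3
        exact absurd h3 (by norm_num)
      simp only [hF]
      rw [roots_mul (mul_ne_zero hx.2.1.ne_zero (hmP _).ne_zero), hq, zero_add,
        roots_prod_X_sub_C]
    intro x hx y hy hxy
    have h1 : x.1 = y.1 := Finset.val_injective (by
      rw [← hroots x hx, ← hroots y hy, hxy])
    refine Prod.ext h1 ?_
    simp only [hF, h1] at hxy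
    exact mul_right_cancel₀ (hmP _).ne_zero hxy
  have h2 : (S.image F).card ≤ (Finset.univ.filter fun v : Fin n → ZMod p =>
      QuadTimesLinears (vecPoly v)).card := by
    refine card_le_card_filter_vecPoly _ _ fun g hg => ?_
    obtain ⟨x, hx, rfl⟩ := Finset.mem_image.mp hg
    rw [hS, Finset.mem_product, mem_irredPolys, Finset.mem_powersetCard] at hx
    refine ⟨hx.2.1.mul (hmP _), ?_, x.1, x.2, rfl, hx.2.1, hx.2.2.1, hx.2.2.2⟩
    simp only [hF]
    rw [hx.2.1.natDegree_mul (hmP _), hx.2.2.2,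
      natDegree_prod_of_monic _ _ fun a _ => monic_X_sub_C a]
    simp only [natDegree_X_sub_C, Finset.sum_const, smul_eq_mul, mul_one, hx.1.2]
    omega
  rw [Finset.card_image_of_injOn hinj, hS, Finset.card_product, Finset.card_powersetCard,
    Finset.card_univ, ZMod.card] at h2
  have h3 := pow_le_two_mul_card_irredPolys hp 2 (by omega)
  have h4 := pow_le_mul_choose p (n - 2) (by omega)
  obtain ⟨s, rfl⟩ : ∃ s, n = s + 2 := ⟨n - 2, by omega⟩
  simp only [Nat.add_sub_cancel] at *
  calc p ^ (s + 2) = p ^ s * p ^ 2 := pow_add _ _ _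
    _ ≤ (2 ^ s * s.factorial * p.choose s) * (2 * 2 * I.card) := Nat.mul_le_mul h4 h3
    _ = 2 ^ (s + 2) * s.factorial * (p.choose s * I.card) := by ring
    _ ≤ _ := Nat.mul_le_mul_left _ h2

end Densities

open NumberField in
/-- Every rational polynomial splits in some Galois number field. -/
theorem exists_galois_numberField_splits (f : ℚ[X]) (hf : f.Separable) :
    ∃ (K : Type) (_ : Field K) (_ : NumberField K) (_ : IsGalois ℚ K),
      (f.map (algebraMap ℚ K)).Splits := by
  have key : ∀ (L : Type) [Field L] [A : Algebra ℚ L] [IsSplittingField ℚ L f],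
      ∃ (K : Type) (_ : Field K) (_ : NumberField K) (_ : IsGalois ℚ K),
        (f.map (algebraMap ℚ K)).Splits := by
    intro L _ A _
    have hc : CharZero L := algebraRat.charZero _
    have hgal : IsGalois ℚ L := IsGalois.of_separable_splitting_field (p := f) hf
    have hfin : FiniteDimensional ℚ L := IsSplittingField.finiteDimensional L f
    have hspl := IsSplittingField.splits L f
    obtain rfl : A = DivisionRing.toRatAlgebra := Subsingleton.elim _ _
    exact ⟨L, inferInstance, { to_charZero := hc, to_finiteDimensional := hfin }, hgal, hspl⟩
  exact @key f.SplittingField _ _ (IsSplittingField.splittingField f)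

open NumberField in
/-- Existence of Frobenius elements: for each prime `p` some element of the Galois group of a
separable monic integer polynomial acts on the reductions of the roots as `x ↦ x ^ p`. -/
theorem exists_frobenius_perm {K : Type} [Field K] [NumberField K] [IsGalois ℚ K] (F : ℤ[X])
    (hF : F.Monic) (hsep : (F.map (Int.castRingHom ℚ)).Separable)
    [hs : Fact ((F.map (Int.castRingHom ℚ)).map (algebraMap ℚ K)).Splits]
    (p : ℕ) [hp : Fact p.Prime] :
    ∃ (k : Type) (_ : Field k) (_ : Finite k) (_ : CharP k p)
      (ρ : (F.map (Int.castRingHom ℚ)).rootSet K → k),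
      ∃ s ∈ (Gal.galActionHom (F.map (Int.castRingHom ℚ)) K).range,
        F.map (Int.castRingHom k) = ∏ α, (X - C (ρ α)) ∧ ∀ α, ρ (s α) = ρ α ^ p := by
  set f := F.map (Int.castRingHom ℚ) with hf
  have hfm : f.Monic := hF.map _
  have hpZ : Prime (p : ℤ) := Nat.prime_iff_prime_int.mp hp.out
  have hPp : (Ideal.span {(p : ℤ)}).IsPrime :=
    (Ideal.span_singleton_prime hpZ.ne_zero).mpr hpZ
  obtain ⟨Q, -, hQ, hQP⟩ := Ideal.exists_ideal_over_prime_of_isIntegral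
    (S := 𝓞 K) (Ideal.span {(p : ℤ)}) ⊥ (by
      have : Function.Injective (algebraMap ℤ (𝓞 K)) := FaithfulSMul.algebraMap_injective ℤ (𝓞 K)
      rw [Ideal.comap_bot_of_injective _ this]
      exact bot_le)
  have hpQ : (p : 𝓞 K) ∈ Q := by
    have : (p : ℤ) ∈ Ideal.comap (algebraMap ℤ (𝓞 K)) Q := by
      rw [hQP]; exact Ideal.mem_span_singleton_self _
    simpa using this
  have hQ0 : Q ≠ ⊥ := by
    rintro rfl
    have : (p : 𝓞 K) = 0 := by simpa using hpQ
    exact hp.out.ne_zero (by exact_mod_cast this)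
  have hfin : Finite (𝓞 K ⧸ Q) := Ideal.finiteQuotientOfFreeOfNeBot Q hQ0
  have hmax : Q.IsMaximal := hQ.isMaximal hQ0
  let _ : Field (𝓞 K ⧸ Q) := Ideal.Quotient.field Q
  have hchar : CharP (𝓞 K ⧸ Q) p := by
    rw [CharP.charP_iff_prime_eq_zero hp.out]
    simpa using Ideal.Quotient.eq_zero_iff_mem.mpr hpQ
  obtain ⟨σ, hσ⟩ := IsArithFrobAt.exists_of_isInvariant ℤ Gal(K/ℚ) Q
  have hcard : Nat.card (ℤ ⧸ Q.under ℤ) = p := by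
    have : Q.under ℤ = Ideal.span {(p : ℤ)} := hQP
    rw [this, Nat.card_congr (Int.quotientSpanNatEquivZMod p).toEquiv, Nat.card_zmod]
  have hintegral : ∀ α : f.rootSet K, IsIntegral ℤ (α : K) := by
    intro α
    refine ⟨F, hF, ?_⟩
    have h : aeval (α : K) f = 0 := aeval_eq_zero_of_mem_rootSet α.2
    have h' : algebraMap ℤ K = (algebraMap ℚ K).comp (Int.castRingHom ℚ) := Subsingleton.elim _ _
    rwa [h', ← eval₂_map]
  let α' : f.rootSet K → 𝓞 K := fun α => ⟨α, hintegral α⟩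
  refine ⟨𝓞 K ⧸ Q, inferInstance, hfin, hchar, fun α => Ideal.Quotient.mk Q (α' α),
    Gal.galActionHom f K (Gal.restrict f K σ), ⟨_, rfl⟩, ?_, ?_⟩
  · have hO : F.map (Int.castRingHom (𝓞 K)) = ∏ α, (X - C (α' α)) := by
      apply Polynomial.map_injective (algebraMap (𝓞 K) K) (FaithfulSMul.algebraMap_injective _ _)
      rw [Polynomial.map_map, Polynomial.map_prod]
      have h1 := hs.out.eq_prod_roots
      have h2 : (f.map (algebraMap ℚ K)).leadingCoeff = 1 := hfm.map _
      rw [h2, C_1, one_mul] at h1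
      have h3 : (algebraMap (𝓞 K) K).comp (Int.castRingHom (𝓞 K)) =
          (algebraMap ℚ K).comp (Int.castRingHom ℚ) := Subsingleton.elim _ _
      rw [h3, ← Polynomial.map_map, ← hf]
      conv_lhs => rw [h1]
      have h4 : (f.map (algebraMap ℚ K)).roots.Nodup := nodup_roots (hsep.map)
      rw [← Multiset.dedup_eq_self.mpr h4, ← Multiset.toFinset_val]
      change ∏ x ∈ (f.map (algebraMap ℚ K)).roots.toFinset, (X - C x) = _
      rw [Finset.prod_subtype (p := (· ∈ f.rootSet K)) _ (by intro x; simp [rootSet])]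
      refine Finset.prod_congr (by congr) fun x _ => ?_
      simp
      rfl
    have h6 : (Int.castRingHom (𝓞 K ⧸ Q)) = (Ideal.Quotient.mk Q).comp (Int.castRingHom (𝓞 K)) :=
      Subsingleton.elim _ _
    rw [h6, ← Polynomial.map_map, hO, Polynomial.map_prod]
    simp
    rfl
  · intro α
    have h7 : α' (Gal.galActionHom f K (Gal.restrict f K σ) α) = σ • α' α := by
      apply RingOfIntegers.ext
      change ((Gal.galActionHom f K (Gal.restrict f K σ) α : f.rootSet K) : K) = _
      rw [Gal.galActionHom_restrict]
      rfl
    have h8 := hσ.mk_apply (α' α)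
    rw [hcard] at h8
    simp only [h7]
    exact h8

/-- A transitive permutation group containing a transposition and an element fixing a point and
acting transitively on the other points is the full symmetric group. -/
theorem subgroup_perm_eq_top {R : Type*} [Finite R] (H : Subgroup (Equiv.Perm R))
    (htrans : ∀ x y, ∃ h ∈ H, h x = y) {s τ : Equiv.Perm R} {x₀ : R} (hs : s ∈ H)
    (hfix : s x₀ = x₀) (hcyc : ∀ β γ, β ≠ x₀ → γ ≠ x₀ → ∃ i : ℕ, (s ^ i) β = γ)
    (hτ : τ ∈ H) (hswap : τ.IsSwap) : H = ⊤ := by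
  have hconj : ∀ {h : Equiv.Perm R} {u v : R}, h ∈ H → Equiv.swap u v ∈ H →
      Equiv.swap (h u) (h v) ∈ H := by
    intro h u v hh huv
    rw [Equiv.swap_apply_apply]
    exact H.mul_mem (H.mul_mem hh huv) (H.inv_mem hh)
  obtain ⟨u, v, huv, rfl⟩ := hswap
  obtain ⟨h, hh, hu⟩ := htrans u x₀
  have h1 : Equiv.swap x₀ (h v) ∈ H := hu ▸ hconj hh hτ
  have hv : h v ≠ x₀ := fun e => huv (h.injective (hu.trans e.symm))
  have h2 : ∀ y, y ≠ x₀ → Equiv.swap x₀ y ∈ H := by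
    intro y hy
    obtain ⟨i, hi⟩ := hcyc _ _ hv hy
    have h3 := hconj (H.pow_mem hs i) h1
    rwa [hi, Equiv.Perm.pow_apply_eq_self_of_apply_eq_self hfix i] at h3
  rw [eq_top_iff, ← Equiv.Perm.closure_isSwap, Subgroup.closure_le]
  rintro _ ⟨x, y, hxy, rfl⟩
  obtain ⟨g, hg, hx⟩ := htrans x₀ x
  have h4 := hconj hg (h2 (g⁻¹ y) fun e => hxy (by rw [← hx, ← e]; simp))
  simpa [hx] using h4

section FiniteFieldRoots

theorem apply_pow_eq_pow {R k : Type*} [Monoid k] {p : ℕ} {ρ : R → k} {s : Equiv.Perm R}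
    (hs : ∀ α, ρ (s α) = ρ α ^ p) (i : ℕ) (α : R) :
    ρ ((s ^ i) α) = ρ α ^ p ^ i := by
  induction i with
  | zero => simp
  | succ i ih => rw [pow_succ', Equiv.Perm.mul_apply, hs, ih, ← pow_mul, pow_succ]

variable {p : ℕ} [Fact p.Prime]

/-- Roots of an irreducible polynomial over `𝔽_p` are conjugate under powers of Frobenius. -/
theorem exists_pow_eq_of_irreducible {k : Type*} [Field k] [Finite k] [Algebra (ZMod p) k]
    {h : (ZMod p)[X]} (hh : Irreducible h) {x y : k} (hx : aeval x h = 0) (hy : aeval y h = 0) :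
    ∃ i : ℕ, x ^ p ^ i = y := by
  have hdvd : h ∣ minpoly (ZMod p) y :=
    (minpoly.irreducible (Algebra.IsIntegral.isIntegral y)).dvd_symm hh (minpoly.dvd _ _ hy) 
  have hx' : aeval x (minpoly (ZMod p) y) = 0 := aeval_eq_zero_of_dvd_aeval_eq_zero hdvd hx
  obtain ⟨σ, hσ⟩ := minpoly.exists_algEquiv_of_root (Algebra.IsAlgebraic.isAlgebraic y) hx'
  obtain ⟨i, hi⟩ := (FiniteField.bijective_frobeniusAlgEquivOfAlgebraic_pow (ZMod p) k).2 σ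
  refine ⟨i, ?_⟩
  rw [← hσ, ← hi]
  simp only [AlgEquiv.coe_pow, FiniteField.coe_frobeniusAlgEquivOfAlgebraic_iterate, ZMod.card]

theorem LinearTimesIrred.separable {g : (ZMod p)[X]} (hg : LinearTimesIrred g) :
    g.Separable := by
  obtain ⟨a, h, rfl, -, hirr, hev⟩ := hg
  refine separable_X_sub_C.mul (PerfectField.separable_of_irreducible hirr) ?_
  rw [(irreducible_X_sub_C a).coprime_iff_not_dvd, dvd_iff_isRoot]
  exact hev

theorem QuadTimesLinears.separable {g : (ZMod p)[X]} (hg : QuadTimesLinears g) :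
    g.Separable := by
  obtain ⟨A, q, rfl, -, hirr, hdeg⟩ := hg
  refine (PerfectField.separable_of_irreducible hirr).mul
    (separable_prod_X_sub_C_iff'.mpr fun x _ y _ h => h) ?_
  refine IsCoprime.prod_right fun a _ => ?_
  rw [hirr.coprime_iff_not_dvd]
  intro hd
  have := natDegree_le_of_dvd hd (X_sub_C_ne_zero a)
  rw [hdeg, natDegree_X_sub_C] at this
  omega

variable {R : Type*} [Fintype R] {k : Type*} [Field k] [Algebra (ZMod p) k]
  {g : (ZMod p)[X]} {ρ : R → k} {s : Equiv.Perm R}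

theorem injective_of_separable_of_map_eq_prod (hg : g.Separable)
    (hprod : g.map (algebraMap (ZMod p) k) = ∏ α, (X - C (ρ α))) : Function.Injective ρ := by
  rw [← separable_prod_X_sub_C_iff, ← hprod]
  exact hg.map

theorem aeval_eq_zero_of_map_eq_prod
    (hprod : g.map (algebraMap (ZMod p) k) = ∏ α, (X - C (ρ α))) (α : R) :
    aeval (ρ α) g = 0 := by
  rw [aeval_def, ← eval_map, hprod, eval_prod]
  exact Finset.prod_eq_zero (Finset.mem_univ α) (by simp)

variable [Finite k]

/-- If the reduction is a linear factor times an irreducible one, Frobenius fixes one root and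
permutes the others transitively. -/
theorem LinearTimesIrred.exists_fixed (hg : LinearTimesIrred g)
    (hprod : g.map (algebraMap (ZMod p) k) = ∏ α, (X - C (ρ α)))
    (hs : ∀ α, ρ (s α) = ρ α ^ p) :
    ∃ x₀, s x₀ = x₀ ∧ ∀ β γ, β ≠ x₀ → γ ≠ x₀ → ∃ i : ℕ, (s ^ i) β = γ := by
  have hinj := injective_of_separable_of_map_eq_prod hg.separable hprod
  obtain ⟨a, h, rfl, -, hirr, -⟩ := hg
  obtain ⟨x₀, hx₀⟩ : ∃ x₀, ρ x₀ = algebraMap (ZMod p) k a := by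
    have h1 := congrArg (eval (algebraMap (ZMod p) k a)) hprod
    rw [eval_prod] at h1
    simp only [Polynomial.map_mul, Polynomial.map_sub, map_X, map_C, eval_mul, eval_sub, eval_X,
      eval_C, sub_self, zero_mul] at h1
    obtain ⟨x, -, hx⟩ := Finset.prod_eq_zero_iff.mp h1.symm
    exact ⟨x, (sub_eq_zero.mp hx).symm⟩
  have hroot : ∀ β, β ≠ x₀ → aeval (ρ β) h = 0 := by
    intro β hβ
    have h2 := aeval_eq_zero_of_map_eq_prod hprod β
    rw [map_mul] at h2
    refine (mul_eq_zero.mp h2).resolve_left fun h3 => hβ (hinj ?_)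
    rw [hx₀]
    simpa [sub_eq_zero] using h3
  refine ⟨x₀, hinj ?_, fun β γ hβ hγ => ?_⟩
  · rw [hs, hx₀, ← map_pow, ZMod.pow_card]
  · obtain ⟨i, hi⟩ := exists_pow_eq_of_irreducible hirr (hroot β hβ) (hroot γ hγ)
    exact ⟨i, hinj ((apply_pow_eq_pow hs i β).trans hi)⟩

/-- If the reduction is an irreducible quadratic times distinct linear factors, Frobenius acts
as a transposition. -/
theorem QuadTimesLinears.isSwap (hg : QuadTimesLinears g)
    (hprod : g.map (algebraMap (ZMod p) k) = ∏ α, (X - C (ρ α)))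
    (hs : ∀ α, ρ (s α) = ρ α ^ p) : s.IsSwap := by
  have hinj := injective_of_separable_of_map_eq_prod hg.separable hprod
  have hroot := aeval_eq_zero_of_map_eq_prod hprod
  obtain ⟨A, q, rfl, hqm, hirr, hdeg⟩ := hg
  set T : Finset R := univ.filter fun α => aeval (ρ α) q = 0 with hT
  have hA : ∀ α, α ∉ T → ∃ a ∈ A, ρ α = algebraMap (ZMod p) k a := by
    intro α hα
    have h2 := hroot α
    rw [map_mul, map_prod] at h2
    have h3 := (mul_eq_zero.mp h2).resolve_left (by simpa [hT] using hα)
    obtain ⟨a, ha, h4⟩ := Finset.prod_eq_zero_iff.mp h3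
    exact ⟨a, ha, by simpa [sub_eq_zero] using h4⟩
  have hcardR : Fintype.card R = 2 + A.card := by
    have h := congrArg natDegree hprod
    rw [natDegree_map, natDegree_mul hirr.ne_zero
      (Finset.prod_ne_zero_iff.mpr fun a _ => X_sub_C_ne_zero a), hdeg, natDegree_prod_of_monic
      _ _ (fun a _ => monic_X_sub_C a), natDegree_prod_of_monic _ _ (fun a _ => monic_X_sub_C _)]
      at h
    simpa using h.symm
  have hTcard : 2 ≤ T.card := by
    have h5 : Tᶜ.card ≤ (A.image (algebraMap (ZMod p) k)).card := by
      refine Finset.card_le_card_of_injOn ρ (fun α hα => ?_) hinj.injOn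
      obtain ⟨a, ha, h6⟩ := hA α (by simpa using hα)
      simp only [Finset.coe_image, Set.mem_image, Finset.mem_coe]
      exact ⟨a, ha, h6.symm⟩
    have h7 := h5.trans Finset.card_image_le
    rw [Finset.card_compl] at h7
    omega
  have hTcard' : T.card ≤ 2 := by
    have h8 : T.card ≤ (q.map (algebraMap (ZMod p) k)).roots.toFinset.card := by
      refine Finset.card_le_card_of_injOn ρ (fun α hα => ?_) hinj.injOn
      have h9 : aeval (ρ α) q = 0 := by simpa [hT] using hα
      simp only [Finset.mem_coe, Multiset.mem_toFinset]
      rw [mem_roots ((hqm.map _).ne_zero), IsRoot.def, eval_map]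
      exact h9
    have h10 := (Multiset.toFinset_card_le _).trans
      (card_roots' (q.map (algebraMap (ZMod p) k)))
    rw [natDegree_map, hdeg] at h10
    omega
  have hsupp : s.support ⊆ T := by
    intro α hα
    by_contra hαT
    obtain ⟨a, -, ha⟩ := hA α hαT
    refine Equiv.Perm.mem_support.mp hα (hinj ?_)
    rw [hs, ha, ← map_pow, ZMod.pow_card]
  have hne : s.support.card ≠ 0 := by
    intro h0
    rw [Finset.card_eq_zero, Equiv.Perm.support_eq_empty_iff] at h0
    obtain ⟨x, hx, y, hy, hxy⟩ := Finset.one_lt_card.mp (by omega : 1 < T.card)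
    obtain ⟨i, hi⟩ := exists_pow_eq_of_irreducible hirr
      (by simpa [hT] using hx) (by simpa [hT] using hy)
    apply hxy
    apply hinj
    rw [← hi, ← apply_pow_eq_pow hs, h0]
    simp
  have h11 := (Finset.card_le_card hsupp).trans hTcard'
  have h12 : s.support.card ≠ 1 := Equiv.Perm.card_support_ne_one s
  exact Equiv.Perm.card_support_eq_two.mp (by omega)

end FiniteFieldRoots

theorem map_map_algebraMap_zmod {p : ℕ} {k : Type*} [Field k] [Algebra (ZMod p) k] (F : ℤ[X]) :
    (F.map (Int.castRingHom (ZMod p))).map (algebraMap (ZMod p) k) =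
      F.map (Int.castRingHom k) := by
  rw [Polynomial.map_map]
  congr 1
  exact Subsingleton.elim _ _

/-- A criterion for the Galois group to be symmetric in terms of reductions modulo primes. -/
theorem isSnPoly_of_reductions {n : ℕ} (a : Fin n → ℤ)
    (h₁ : ∃ (p : ℕ) (_ : Fact p.Prime), Irreducible (vecPoly (redVec p a)))
    (h₂ : ∃ (p : ℕ) (_ : Fact p.Prime), LinearTimesIrred (vecPoly (redVec p a)))
    (h₃ : ∃ (p : ℕ) (_ : Fact p.Prime), QuadTimesLinears (vecPoly (redVec p a))) :
    IsSnPoly n a := by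
  obtain ⟨p₁, hp₁, h₁⟩ := h₁
  obtain ⟨p₂, hp₂, h₂⟩ := h₂
  obtain ⟨p₃, hp₃, h₃⟩ := h₃
  rw [← intPoly_map_zmod] at h₁ h₂ h₃
  have hmonic : (intPoly n a).Monic := monic_vecPoly a
  have hnat : (intPoly n a).natDegree = n := natDegree_vecPoly a
  have hirrZ : Irreducible (intPoly n a) :=
    hmonic.irreducible_of_irreducible_map _ _ h₁
  have hirr : Irreducible (ratPoly n a) :=
    (hmonic.irreducible_iff_irreducible_map_fraction_map (K := ℚ)).mp hirrZ
  have hsep : (ratPoly n a).Separable := hirr.separable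
  obtain ⟨K, _, _, _, hspl⟩ := exists_galois_numberField_splits _ hsep
  have : Fact ((ratPoly n a).map (algebraMap ℚ K)).Splits := ⟨hspl⟩
  have htop : (Gal.galActionHom (ratPoly n a) K).range = ⊤ := by
    obtain ⟨k, _, _, _, ρ, s, hs, hprod, hfrob⟩ :=
      exists_frobenius_perm (K := K) (hs := ⟨hspl⟩) (intPoly n a) hmonic hsep p₂
    let _ := ZMod.algebra k p₂
    rw [← map_map_algebraMap_zmod (p := p₂)] at hprod
    obtain ⟨x₀, hfix, hcyc⟩ := h₂.exists_fixed hprod hfrob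
    obtain ⟨k', _, _, _, ρ', s', hs', hprod', hfrob'⟩ :=
      exists_frobenius_perm (K := K) (hs := ⟨hspl⟩) (intPoly n a) hmonic hsep p₃
    let _ := ZMod.algebra k' p₃
    rw [← map_map_algebraMap_zmod (p := p₃)] at hprod'
    have hswap := h₃.isSwap hprod' hfrob'
    refine subgroup_perm_eq_top _ (fun x y => ?_) hs hfix hcyc hs' hswap
    have := Gal.galAction_isPretransitive (ratPoly n a) K hirr
    obtain ⟨g, hg⟩ := MulAction.exists_smul_eq (ratPoly n a).Gal x y
    exact ⟨_, ⟨g, rfl⟩, hg⟩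
  have hbij : Function.Bijective (Gal.galActionHom (ratPoly n a) K) :=
    ⟨Gal.galActionHom_injective _ _, MonoidHom.range_eq_top.mp htop⟩
  have hcard : Fintype.card ((ratPoly n a).rootSet K) = n := by
    rw [card_rootSet_eq_natDegree hsep hspl, ratPoly, natDegree_map_eq_of_injective
      (RingHom.injective_int _), hnat]
  exact ⟨(MulEquiv.ofBijective _ hbij).trans (Fintype.equivFinOfCardEq hcard).permCongrHom⟩

theorem primePi_eq_primeCounting (x : ℝ) : primePi x = Nat.primeCounting ⌊x⌋₊ := by
  rw [primePi, Nat.primeCounting, Nat.primeCounting', Nat.count_eq_card_filter_range]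

theorem eventually_log_le_mul_rpow {ε s : ℝ} (hε : 0 < ε) (hs : 0 < s) :
    ∀ᶠ x : ℝ in atTop, Real.log x ≤ ε * x ^ s := by
  have h := (isLittleO_log_rpow_atTop hs).bound hε
  filter_upwards [h, eventually_ge_atTop 1] with x hx h1
  rw [Real.norm_eq_abs, Real.norm_eq_abs, abs_of_nonneg (by positivity : (0:ℝ) ≤ x ^ s)] at hx
  exact (le_abs_self _).trans hx

theorem eventually_div_log_le_primePi :
    ∀ᶠ x : ℝ in atTop, x / (2 * Real.log x) ≤ primePi x := by
  have h := eventually_log_le_mul_rpow (ε := 1 / 20) (s := 1) (by norm_num) one_pos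
  have h' := (tendsto_atTop_add_const_right atTop (2 : ℝ) tendsto_id).eventually h
  filter_upwards [h', eventually_ge_atTop 100] with x hx h1
  have hlog : 0 < Real.log x := Real.log_pos (by linarith)
  rw [primePi_eq_primeCounting]
  refine le_trans ?_ (Chebyshev.pi_ge' (by linarith : (1 : ℝ) < x))
  rw [div_le_div_iff₀ (by positivity) hlog]
  have h2 := Real.log_two_gt_d9
  simp only [id, Real.rpow_one] at hx
  have h3 : x / 2 ≤ (x - 1) * Real.log 2 - Real.log (x + 2) := by nlinarith
  nlinarith

theorem eventually_sqrt_add_le_primePi (B : ℝ) :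
    ∀ᶠ x : ℝ in atTop, √x + B ≤ primePi x := by
  have h := eventually_log_le_mul_rpow (ε := 1 / 8) (s := 1 / 2) (by norm_num) (by norm_num)
  filter_upwards [eventually_div_log_le_primePi, h, eventually_ge_atTop 100,
    eventually_ge_atTop (B ^ 2)] with x h1 h2 h3 h4
  refine le_trans ?_ h1
  have hlog : 0 < Real.log x := Real.log_pos (by linarith)
  rw [← Real.sqrt_eq_rpow] at h2
  have hs := Real.sq_sqrt (by linarith : (0 : ℝ) ≤ x)
  have hs0 := Real.sqrt_nonneg x
  have hB : B ≤ √x := Real.le_sqrt_of_sq_le h4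
  rw [le_div_iff₀ (by positivity)]
  nlinarith

/-- The indicator function of `P` on a finite type, centred to have mean zero. -/
def centeredInd {V : Type*} [Fintype V] (P : V → Prop) (v : V) : ℝ :=
  (if P v then 1 else 0) - ((univ.filter P).card : ℝ) / Fintype.card V

section centeredInd

variable {V : Type*} [Fintype V] (P : V → Prop)

theorem density_nonneg : 0 ≤ ((univ.filter P).card : ℝ) / Fintype.card V := by positivity

theorem density_le_one : ((univ.filter P).card : ℝ) / Fintype.card V ≤ 1 :=
  div_le_one_of_le₀ (by exact_mod_cast Finset.card_le_univ _) (by positivity)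

theorem abs_centeredInd_le_one (v : V) : |centeredInd P v| ≤ 1 := by
  have h0 := density_nonneg P
  have h1 := density_le_one P
  rw [centeredInd, abs_le]
  split_ifs <;> constructor <;> linarith

variable [Nonempty V]

theorem sum_centeredInd : ∑ v, centeredInd P v = 0 := by
  have : (Fintype.card V : ℝ) ≠ 0 := by exact_mod_cast Fintype.card_ne_zero
  simp only [centeredInd, Finset.sum_sub_distrib, Finset.sum_boole, Finset.sum_const,
    Finset.card_univ, nsmul_eq_mul]
  field_simp
  simp

theorem mean_centeredInd_sq : (∑ v, centeredInd P v ^ 2) / Fintype.card V =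
    (((univ.filter P).card : ℝ) / Fintype.card V) *
      (1 - ((univ.filter P).card : ℝ) / Fintype.card V) := by
  have hV : (Fintype.card V : ℝ) ≠ 0 := by exact_mod_cast Fintype.card_ne_zero
  set d := ((univ.filter P).card : ℝ) / Fintype.card V with hd
  have h : ∀ v, centeredInd P v ^ 2 = (if P v then 1 else 0) * (1 - 2 * d) + d ^ 2 := by
    intro v
    rw [centeredInd, ← hd]
    split_ifs <;> ring
  simp only [h, Finset.sum_add_distrib, ← Finset.sum_mul, Finset.sum_boole, Finset.sum_const,
    Finset.card_univ, nsmul_eq_mul]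
  have hc : ((univ.filter P).card : ℝ) = d * Fintype.card V := by rw [hd]; field_simp
  rw [hc]
  field_simp
  ring

theorem abs_mean_centeredInd_pow_le {l : ℕ} (hl : 2 ≤ l) :
    |(∑ v, centeredInd P v ^ l) / Fintype.card V| ≤
      (((univ.filter P).card : ℝ) / Fintype.card V) *
        (1 - ((univ.filter P).card : ℝ) / Fintype.card V) := by
  rw [← mean_centeredInd_sq, abs_div, Nat.abs_cast]
  gcongr
  refine (Finset.abs_sum_le_sum_abs _ _).trans (Finset.sum_le_sum fun v _ => ?_)
  rw [abs_pow, ← sq_abs]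
  exact pow_le_pow_of_le_one (abs_nonneg _) (abs_centeredInd_le_one P v) hl

end centeredInd

theorem add_pow_sub_pow_le {M Q : ℝ} (hQ : 0 ≤ Q) (hQM : Q ≤ M) (n : ℕ) :
    (M + Q) ^ (n + 1) - M ^ (n + 1) ≤ 2 ^ (n + 1) * (Q * M ^ n) := by
  have hM : 0 ≤ M := hQ.trans hQM
  induction n with
  | zero => simp; linarith
  | succ n ih =>
    have h1 : (M + Q) ^ (n + 1) ≤ (2 * M) ^ (n + 1) := by gcongr; linarith
    rw [mul_pow] at h1
    have h2 : (M + Q) ^ (n + 1 + 1) - M ^ (n + 1 + 1) =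
        M * ((M + Q) ^ (n + 1) - M ^ (n + 1)) + Q * (M + Q) ^ (n + 1) := by ring
    rw [h2]
    have h3 := mul_le_mul_of_nonneg_left ih hM
    have h4 := mul_le_mul_of_nonneg_left h1 hQ
    calc _ ≤ M * (2 ^ (n + 1) * (Q * M ^ n)) + Q * (2 ^ (n + 1) * M ^ (n + 1)) := add_le_add h3 h4
      _ = _ := by ring

/-- Moments of sums of centred indicators over the coefficient box. -/
theorem abs_sum_coeffBox_centeredInd_pow_le {ι : Type*} [Fintype ι] (m : ι → ℕ)
    [hm : ∀ i, Fact (m i).Prime] (hinj : Function.Injective m) (n N k Z : ℕ) (hk : 1 ≤ k)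
    (hZ : 1 ≤ Z) (hmZ : ∀ i, m i ≤ Z) (P : ∀ i, (Fin n → ZMod (m i)) → Prop) {v t x : ℝ}
    (hv0 : 0 ≤ v) (ht : 0 < t) (ht1 : t ≤ 1) (hx : 0 < x)
    (hv : ∀ i, ((univ.filter (P i)).card : ℝ) / (m i : ℝ) ^ n *
      (1 - ((univ.filter (P i)).card : ℝ) / (m i : ℝ) ^ n) ≤ v) :
    |∑ a ∈ coeffBox n N, (∑ i, centeredInd (P i) (redVec (m i) a)) ^ k| ≤
      (2 * N + 1 : ℝ) ^ n * ((t⁻¹) ^ (k / 2) * k.factorial * (x⁻¹) ^ k *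
        Real.exp (Fintype.card ι * (t * v) * (Real.exp x - 1 - x))) +
      (Fintype.card ι : ℝ) ^ k * ((2 * N + 1 + (Z : ℝ) ^ k) ^ n - (2 * N + 1 : ℝ) ^ n) := by
  have hcard : ∀ i, ((Fintype.card (Fin n → ZMod (m i)) : ℕ) : ℝ) = (m i : ℝ) ^ n := by
    intro i; simp
  have hcop : Pairwise (Function.onFun Nat.Coprime m) := fun i j hij =>
    (Nat.coprime_primes (hm i).out (hm j).out).mpr fun h => hij (hinj h)
  have h1 := abs_sum_coeffBox_pow_sub_le m hcop n N k Z hZ hmZ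
    (fun i => centeredInd (P i)) (fun i v => abs_centeredInd_le_one (P i) v)
  have h2 := abs_sum_multinomial_le
    (fun i j => (∑ v, centeredInd (P i) v ^ j) / (m i : ℝ) ^ n) k hk v t x hv0 ht ht1 hx
    (fun i => by
      have : (m i : ℝ) ≠ 0 := by exact_mod_cast (hm i).out.ne_zero
      simp [this])
    (fun i => by simp [sum_centeredInd])
    (fun i l hl => by
      refine le_trans ?_ (hv i)
      rw [← hcard]
      exact abs_mean_centeredInd_pow_le (P i) hl)
  have h3 := abs_sub_abs_le_abs_sub (∑ a ∈ coeffBox n N,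
    (∑ i, centeredInd (P i) (redVec (m i) a)) ^ k) ((2 * N + 1 : ℝ) ^ n *
      ∑ j ∈ piAntidiag univ k, (Nat.multinomial univ j : ℝ) *
        ∏ i, ((∑ v, centeredInd (P i) v ^ j i) / (m i : ℝ) ^ n))
  rw [abs_mul, abs_of_nonneg (by positivity : (0 : ℝ) ≤ (2 * N + 1 : ℝ) ^ n)] at h3
  have h4 := mul_le_mul_of_nonneg_left h2 (by positivity : (0 : ℝ) ≤ (2 * N + 1 : ℝ) ^ n)
  linarith

/-- Few vectors of the box avoid a property of positive density modulo every prime of a set. -/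
theorem card_avoiding_mul_le {ι : Type*} [Fintype ι] [Nonempty ι] (m : ι → ℕ)
    [hm : ∀ i, Fact (m i).Prime] (hinj : Function.Injective m) (n N w : ℕ)
    (hw : 1 ≤ w) (hwN : w ^ 2 ≤ 2 * N + 1) (hmw : ∀ i, m i ≤ w)
    (P : ∀ i, (Fin (n + 1) → ZMod (m i)) → Prop) {c : ℝ} (hc : 0 ≤ c)
    (hP : ∀ i, c * (m i : ℝ) ^ (n + 1) ≤ (univ.filter (P i)).card) :
    (((coeffBox (n + 1) N).filter fun a => ∀ i, ¬ P i (redVec (m i) a)).card : ℝ) * c ^ 2 ≤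
      (2 * N + 1 : ℝ) ^ (n + 1) *
        (6 / Fintype.card ι + 2 ^ (n + 1) * ((w : ℝ) ^ 2 / (2 * N + 1))) := by
  set s := (Fintype.card ι : ℝ) with hs
  have hs0 : 0 < s := by rw [hs]; exact_mod_cast Fintype.card_pos
  have hs1 : 1 ≤ s := by rw [hs]; exact_mod_cast Fintype.card_pos
  set M : ℝ := 2 * N + 1 with hM
  have hM0 : 0 < M := by positivity
  have hsq : √s ^ 2 = s := Real.sq_sqrt hs0.le
  have hsq1 : 1 ≤ √s := Real.one_le_sqrt.mpr hs1
  have hd : ∀ i, c ≤ ((univ.filter (P i)).card : ℝ) / (m i : ℝ) ^ (n + 1) := by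
    intro i
    have : (0 : ℝ) < (m i : ℝ) ^ (n + 1) := by
      have := (hm i).out.pos
      positivity
    rw [le_div_iff₀ this]
    exact hP i
  have h1 := abs_sum_coeffBox_centeredInd_pow_le m hinj (n + 1) N 2 w one_le_two hw hmw P
    (v := 1) (t := 1) (x := (√s)⁻¹) zero_le_one one_pos le_rfl (by positivity) (fun i => by
      set d := ((univ.filter (P i)).card : ℝ) / (m i : ℝ) ^ (n + 1)
      nlinarith [sq_nonneg (d - 1), sq_nonneg d])
  have hexp : Real.exp (s * (1 * 1) * (Real.exp (√s)⁻¹ - 1 - (√s)⁻¹)) ≤ 3 := by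
    have h2 := exp_sub_one_sub_le (x := (√s)⁻¹) (by positivity) (inv_le_one_of_one_le₀ hsq1)
    have h3 : (√s)⁻¹ ≤ 1 := inv_le_one_of_one_le₀ hsq1
    have h4 : ((√s)⁻¹) ^ 2 = s⁻¹ := by rw [inv_pow, hsq]
    have h5 : Real.exp (√s)⁻¹ - 1 - (√s)⁻¹ ≤ s⁻¹ := by
      rw [h4] at h2
      have : 0 < s⁻¹ := by positivity
      nlinarith
    have h6 : s * (1 * 1) * (Real.exp (√s)⁻¹ - 1 - (√s)⁻¹) ≤ 1 := by
      calc _ ≤ s * (1 * 1) * s⁻¹ := by gcongr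
        _ = 1 := by field_simp
    exact (Real.exp_le_exp.mpr h6).trans (by linarith [Real.exp_one_lt_d9])
  have h7 : (((coeffBox (n + 1) N).filter fun a => ∀ i, ¬ P i (redVec (m i) a)).card : ℝ) *
      (c * s) ^ 2 ≤ ∑ a ∈ coeffBox (n + 1) N,
        (∑ i, centeredInd (P i) (redVec (m i) a)) ^ 2 := by
    rw [← nsmul_eq_mul, ← Finset.sum_const]
    refine (Finset.sum_le_sum fun a ha => ?_).trans
      (Finset.sum_le_sum_of_subset_of_nonneg (Finset.filter_subset _ _)
        fun a _ _ => sq_nonneg _)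
    rw [Finset.mem_filter] at ha
    rw [← neg_sq (∑ i, _), ← Finset.sum_neg_distrib]
    have h8 : c * s ≤ ∑ i, -centeredInd (P i) (redVec (m i) a) := by
      have : c * s = ∑ i : ι, c := by simp [hs, mul_comm]
      rw [this]
      refine Finset.sum_le_sum fun i _ => ?_
      rw [centeredInd, if_neg (ha.2 i)]
      simpa using hd i
    gcongr
  have h9 := h7.trans ((le_abs_self _).trans h1)
  have h10 := add_pow_sub_pow_le (M := M) (Q := (w : ℝ) ^ 2) (by positivity)
    (by rw [hM]; exact_mod_cast hwN) n
  have h11 : (1 : ℝ)⁻¹ ^ (2 / 2) * (Nat.factorial 2 : ℕ) * ((√s)⁻¹)⁻¹ ^ 2 *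
      Real.exp (s * (1 * 1) * (Real.exp (√s)⁻¹ - 1 - (√s)⁻¹)) ≤ 6 * s := by
    rw [inv_inv, hsq]
    norm_num [Nat.factorial] at hexp ⊢
    nlinarith
  have h12 : (((coeffBox (n + 1) N).filter fun a => ∀ i, ¬ P i (redVec (m i) a)).card : ℝ) *
      (c * s) ^ 2 ≤ M ^ (n + 1) * (6 * s) + s ^ 2 * (2 ^ (n + 1) * ((w : ℝ) ^ 2 * M ^ n)) := by
    refine h9.trans (add_le_add ?_ ?_)
    · gcongr
    · gcongr
  have h13 : M ^ (n + 1) * (6 / s + 2 ^ (n + 1) * ((w : ℝ) ^ 2 / M)) * s ^ 2 =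
      M ^ (n + 1) * (6 * s) + s ^ 2 * (2 ^ (n + 1) * ((w : ℝ) ^ 2 * M ^ n)) := by
    field_simp
    ring
  rw [← mul_le_mul_iff_of_pos_right (by positivity : 0 < s ^ 2), h13]
  linarith [h12]

/-- A property holding with positive density modulo every large prime holds modulo some prime,
for all vectors of the box outside a set of power-saving size. -/
theorem exists_card_avoiding_le (n : ℕ) (P : ∀ p, (Fin (n + 1) → ZMod p) → Prop) {c : ℝ}
    (hc : 0 < c) (p₀ : ℕ)
    (hP : ∀ p [Fact p.Prime], p₀ ≤ p → c * (p : ℝ) ^ (n + 1) ≤ (univ.filter (P p)).card) :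
    ∃ C > (0 : ℝ), ∀ᶠ N : ℕ in atTop,
      (((coeffBox (n + 1) N).filter fun a =>
        ¬ ∃ (p : ℕ) (_ : Fact p.Prime), P p (redVec p a)).card : ℝ) ≤
        C * ((2 * N + 1 : ℝ) ^ (n + 1) * (N : ℝ) ^ (-(1 / 16) : ℝ)) := by
  refine ⟨(6 + 2 ^ (n + 1)) / c ^ 2, by positivity, ?_⟩
  have htend : Tendsto (fun N : ℕ => (N : ℝ) ^ (1 / 8 : ℝ)) atTop atTop :=
    (tendsto_rpow_atTop (by norm_num)).comp tendsto_natCast_atTop_atTop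
  filter_upwards [htend.eventually (eventually_sqrt_add_le_primePi p₀),
    eventually_ge_atTop 1] with N hpi hN
  have hN1 : (1 : ℝ) ≤ N := by exact_mod_cast hN
  have hN0 : (0 : ℝ) < N := by linarith
  set x := (N : ℝ) ^ (1 / 8 : ℝ) with hx
  have hx1 : 1 ≤ x := Real.one_le_rpow hN1 (by norm_num)
  set w := ⌊x⌋₊ with hw
  have hw1 : 1 ≤ w := Nat.one_le_floor_iff _ |>.mpr hx1
  have hwx : (w : ℝ) ≤ x := Nat.floor_le (by linarith)
  have hx2 : x ^ 2 = (N : ℝ) ^ (1 / 4 : ℝ) := by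
    rw [hx, ← Real.rpow_natCast, ← Real.rpow_mul hN0.le]; norm_num
  have hw2 : (w : ℝ) ^ 2 ≤ (N : ℝ) ^ (1 / 4 : ℝ) := by rw [← hx2]; gcongr
  have hsqrt : √x = (N : ℝ) ^ (1 / 16 : ℝ) := by
    rw [Real.sqrt_eq_rpow, hx, ← Real.rpow_mul hN0.le]; norm_num
  have hwN : w ^ 2 ≤ 2 * N + 1 := by
    have h1 : (N : ℝ) ^ (1 / 4 : ℝ) ≤ (N : ℝ) ^ (1 : ℝ) :=
      Real.rpow_le_rpow_of_exponent_le hN1 (by norm_num)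
    rw [Real.rpow_one] at h1
    have h2 : (w : ℝ) ^ 2 ≤ (2 * N + 1 : ℕ) := by push_cast; linarith
    exact_mod_cast h2
  set S := ((range (w + 1)).filter Nat.Prime).filter (p₀ ≤ ·) with hS
  have hSprime : ∀ i : S, Fact (i : ℕ).Prime := fun i =>
    ⟨(Finset.mem_filter.mp (Finset.mem_filter.mp i.2).1).2⟩
  have hScard : (N : ℝ) ^ (1 / 16 : ℝ) ≤ S.card := by
    have h3 : primePi x ≤ S.card + p₀ := by
      rw [primePi, ← Finset.card_filter_add_card_filter_not (p₀ ≤ ·)]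
      refine Nat.add_le_add_left ?_ _
      calc _ ≤ (range p₀).card := Finset.card_le_card fun p hp => by
            simp only [Finset.mem_filter, not_le] at hp
            exact Finset.mem_range.mpr hp.2
        _ = p₀ := Finset.card_range _
    have h4 : (primePi x : ℝ) ≤ S.card + p₀ := by exact_mod_cast h3
    rw [← hsqrt]
    linarith
  have hpos : (0 : ℝ) < (N : ℝ) ^ (1 / 16 : ℝ) := by positivity
  have hSne : Nonempty S := by
    rw [Finset.nonempty_coe_sort, ← Finset.card_pos]
    exact_mod_cast hpos.trans_le hScard
  have h5 := card_avoiding_mul_le (fun i : S => (i : ℕ)) Subtype.val_injective n N w hw1 hwN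
    (fun i => Nat.lt_succ_iff.mp (Finset.mem_range.mp
      (Finset.mem_filter.mp (Finset.mem_filter.mp i.2).1).1))
    (fun i => P i) hc.le (fun i => hP i (Finset.mem_filter.mp i.2).2)
  have h6 : (((coeffBox (n + 1) N).filter fun a =>
      ¬ ∃ (p : ℕ) (_ : Fact p.Prime), P p (redVec p a)).card : ℝ) ≤
      ((coeffBox (n + 1) N).filter fun a => ∀ i : S, ¬ P i (redVec i a)).card := by
    have h7 : ((coeffBox (n + 1) N).filter fun a =>
      ¬ ∃ (p : ℕ) (_ : Fact p.Prime), P p (redVec p a)) ⊆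
      ((coeffBox (n + 1) N).filter fun a => ∀ i : S, ¬ P i (redVec i a)) := by
      intro a ha
      rw [Finset.mem_filter] at ha ⊢
      exact ⟨ha.1, fun i hi => ha.2 ⟨i, hSprime i, hi⟩⟩
    exact_mod_cast Finset.card_le_card h7
  have h8 : (6 : ℝ) / Fintype.card S ≤ 6 * (N : ℝ) ^ (-(1 / 16) : ℝ) := by
    rw [Real.rpow_neg hN0.le, ← div_eq_mul_inv, Fintype.card_coe]
    gcongr
  have h9 : (w : ℝ) ^ 2 / (2 * N + 1) ≤ (N : ℝ) ^ (-(1 / 16) : ℝ) := by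
    rw [div_le_iff₀ (by positivity)]
    have h10 : (N : ℝ) ^ (-(1 / 16) : ℝ) * N = (N : ℝ) ^ (15 / 16 : ℝ) := by
      rw [← Real.rpow_add_one hN0.ne']; norm_num
    have h11 : (N : ℝ) ^ (1 / 4 : ℝ) ≤ (N : ℝ) ^ (15 / 16 : ℝ) :=
      Real.rpow_le_rpow_of_exponent_le hN1 (by norm_num)
    have h12 : 0 < (N : ℝ) ^ (-(1 / 16) : ℝ) := by positivity
    nlinarith
  have hc2 : 0 < c ^ 2 := by positivity
  rw [div_mul_eq_mul_div, le_div_iff₀ hc2]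
  calc _ ≤ _ := mul_le_mul_of_nonneg_right h6 hc2.le
    _ ≤ _ := h5
    _ ≤ (2 * N + 1 : ℝ) ^ (n + 1) * (6 * (N : ℝ) ^ (-(1 / 16) : ℝ) +
        2 ^ (n + 1) * (N : ℝ) ^ (-(1 / 16) : ℝ)) := by gcongr
    _ = _ := by ring

/-- All but a power-saving proportion of the polynomials in the box have Galois group `S_n`. -/
theorem exists_card_not_isSnPoly_le {n : ℕ} (hn : 2 ≤ n) :
    ∃ C > (0 : ℝ), ∀ᶠ N : ℕ in atTop,
      (((coeffBox n N).filter fun a => ¬ IsSnPoly n a).card : ℝ) ≤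
        C * ((2 * N + 1 : ℝ) ^ n * (N : ℝ) ^ (-(1 / 16) : ℝ)) := by
  have hn0 : n ≠ 0 := by omega
  obtain ⟨d, rfl⟩ := Nat.exists_eq_succ_of_ne_zero hn0
  have hdens : ∀ {p A B : ℕ}, 0 < A → p ^ (d + 1) ≤ A * B →
      (A : ℝ)⁻¹ * (p : ℝ) ^ (d + 1) ≤ (B : ℝ) := by
    intro p A B hA h
    have hA' : (0 : ℝ) < A := by exact_mod_cast hA
    rw [inv_mul_le_iff₀ hA']
    exact_mod_cast h
  have hA₁ : 0 < 2 * (d + 1) := by positivity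
  have hA₂ : 0 < 4 * (d + 1) * (d + 1) := by positivity
  have hA₃ : 0 < 2 ^ (d + 1) * (d + 1 - 2).factorial := by positivity
  obtain ⟨C₁, hC₁, h₁⟩ := exists_card_avoiding_le d (fun p v => Irreducible (vecPoly v))
    (inv_pos.mpr (Nat.cast_pos.mpr hA₁)) 3
    (fun p _ hp => hdens hA₁ (card_irreducible_ge hp hn0))
  obtain ⟨C₂, hC₂, h₂⟩ := exists_card_avoiding_le d
    (fun p v => ∃ _ : Fact p.Prime, LinearTimesIrred (vecPoly v))
    (inv_pos.mpr (Nat.cast_pos.mpr hA₂)) 3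
    (fun p hp' hp => hdens hA₂ (by simpa [hp'] using card_linearTimesIrred_ge hp hn))
  obtain ⟨C₃, hC₃, h₃⟩ := exists_card_avoiding_le d
    (fun p v => ∃ _ : Fact p.Prime, QuadTimesLinears (vecPoly v))
    (inv_pos.mpr (Nat.cast_pos.mpr hA₃)) (2 * (d + 1) + 3)
    (fun p hp' hp => hdens hA₃
      (by simpa [hp'] using card_quadTimesLinears_ge (by omega) hn (by omega)))
  refine ⟨C₁ + C₂ + C₃, by positivity, ?_⟩
  filter_upwards [h₁, h₂, h₃] with N h₁ h₂ h₃
  have hsub : ((coeffBox (d + 1) N).filter fun a => ¬ IsSnPoly (d + 1) a) ⊆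
      (((coeffBox (d + 1) N).filter fun a =>
        ¬ ∃ (p : ℕ) (_ : Fact p.Prime), Irreducible (vecPoly (redVec p a))) ∪
      ((coeffBox (d + 1) N).filter fun a =>
        ¬ ∃ (p : ℕ) (_ : Fact p.Prime), ∃ _ : Fact p.Prime,
          LinearTimesIrred (vecPoly (redVec p a)))) ∪
      ((coeffBox (d + 1) N).filter fun a =>
        ¬ ∃ (p : ℕ) (_ : Fact p.Prime), ∃ _ : Fact p.Prime,
          QuadTimesLinears (vecPoly (redVec p a))) := by
    intro a ha
    simp only [Finset.mem_union, Finset.mem_filter] at ha ⊢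
    by_contra hcon
    push Not at hcon
    obtain ⟨⟨g₁, g₂⟩, g₃⟩ := hcon
    refine ha.2 (isSnPoly_of_reductions a (g₁ ha.1) ?_ ?_)
    · obtain ⟨p, hp, _, h⟩ := g₂ ha.1
      exact ⟨p, hp, h⟩
    · obtain ⟨p, hp, _, h⟩ := g₃ ha.1
      exact ⟨p, hp, h⟩
  have hcard := (Finset.card_le_card hsub).trans
    ((Finset.card_union_le _ _).trans (Nat.add_le_add_right (Finset.card_union_le _ _) _))
  have hcard' : (((coeffBox (d + 1) N).filter fun a => ¬ IsSnPoly (d + 1) a).card : ℝ) ≤ _ :=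
    Nat.cast_le.mpr hcard
  push_cast at hcard' ⊢
  simp only [Nat.succ_eq_add_one] at h₁ h₂ h₃ ⊢
  linarith

theorem factorial_mul_exp_le (m : ℕ) (hm : 1 ≤ m) :
    (m.factorial : ℝ) * Real.exp m ≤ Real.exp 1 * (m : ℝ) ^ (m + 1) := by
  induction m, hm using Nat.le_induction with
  | base => simp
  | succ m hm ih =>
    have hm0 : (0 : ℝ) < m := by exact_mod_cast hm
    have h1 : Real.exp 1 * (m : ℝ) ^ (m + 1) ≤ ((m : ℝ) + 1) ^ (m + 1) := by
      have h2 : (m : ℝ) / (m + 1) ≤ Real.exp (-(1 / ((m : ℝ) + 1))) := by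
        have h3 := Real.add_one_le_exp (-(1 / ((m : ℝ) + 1)))
        have h4 : (m : ℝ) / (m + 1) = -(1 / ((m : ℝ) + 1)) + 1 := by field_simp; ring
        linarith
      have h5 : ((m : ℝ) / (m + 1)) ^ (m + 1) ≤ Real.exp (-1) := by
        refine (pow_le_pow_left₀ (by positivity) h2 (m + 1)).trans (le_of_eq ?_)
        rw [← Real.exp_nat_mul]
        congr 1
        push_cast
        field_simp
      rw [div_pow, div_le_iff₀ (by positivity), Real.exp_neg] at h5
      have h6 := mul_le_mul_of_nonneg_left h5 (Real.exp_pos 1).le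
      rwa [← mul_assoc, mul_inv_cancel₀ (Real.exp_pos 1).ne', one_mul] at h6
    rw [Nat.factorial_succ]
    push_cast
    rw [Real.exp_add]
    calc ((m : ℝ) + 1) * m.factorial * (Real.exp m * Real.exp 1)
        = Real.exp 1 * (m + 1) * (m.factorial * Real.exp m) := by ring
      _ ≤ Real.exp 1 * (m + 1) * (Real.exp 1 * (m : ℝ) ^ (m + 1)) := by gcongr
      _ ≤ Real.exp 1 * (m + 1) * ((m : ℝ) + 1) ^ (m + 1) := by gcongr
      _ = _ := by ring

theorem two_pow_mul_factorial_mul_exp_le (m : ℕ) :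
    (2 : ℝ) ^ m * m.factorial * Real.exp m ≤ Real.exp 1 * (2 * m + 1 : ℝ) ^ (m + 1) := by
  rcases Nat.eq_zero_or_pos m with rfl | hm
  · simp
  · have h := factorial_mul_exp_le m hm
    have hm0 : (0 : ℝ) ≤ m := by positivity
    calc (2 : ℝ) ^ m * m.factorial * Real.exp m
        = 2 ^ m * (m.factorial * Real.exp m) := by ring
      _ ≤ 2 ^ m * (Real.exp 1 * (m : ℝ) ^ (m + 1)) := by gcongr
      _ = Real.exp 1 * ((2 * (m : ℝ)) ^ m * m) := by rw [mul_pow]; ring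
      _ ≤ Real.exp 1 * ((2 * (m : ℝ) + 1) ^ m * (2 * m + 1)) := by
        gcongr <;> linarith
      _ = _ := by ring

/-- The exponential bound for odd moments, optimised at `t = 4k / (δ³ s)` and `x = δ / 2`. -/
theorem odd_moment_bound {δ s : ℝ} (hδ : 0 < δ) (hδ1 : δ ≤ 1) (hs : 0 < s) (m : ℕ) :
    ((4 * (2 * m + 1) / (δ ^ 3 * s))⁻¹) ^ m * (2 * m + 1).factorial * ((δ / 2)⁻¹) ^ (2 * m + 1) *
      Real.exp (s * (4 * (2 * m + 1) / (δ ^ 3 * s) * (δ * (1 - δ / 2))) *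
        (Real.exp (δ / 2) - 1 - δ / 2)) ≤
    2 * Real.exp 2 / δ * (δ ^ m * (2 * m + 1).factorial / (2 ^ m * m.factorial) * s ^ m *
      (2 * m + 1)) := by
  have h1 := exp_sub_one_sub_le (x := δ / 2) (by positivity) (by linarith)
  have hexp : s * (4 * (2 * m + 1) / (δ ^ 3 * s) * (δ * (1 - δ / 2))) *
      (Real.exp (δ / 2) - 1 - δ / 2) ≤ m + 1 := by
    have hpos : 0 ≤ 1 - δ / 2 := by linarith
    calc _ ≤ s * (4 * (2 * m + 1) / (δ ^ 3 * s) * (δ * (1 - δ / 2))) *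
          ((δ / 2) ^ 2 / 2 * (1 + δ / 2)) := by gcongr
      _ = (2 * m + 1) / 2 * (1 - (δ / 2) ^ 2) := by field_simp; ring
      _ ≤ (2 * m + 1) / 2 * 1 := by gcongr; nlinarith
      _ ≤ _ := by linarith
  have h2 : Real.exp (s * (4 * (2 * m + 1) / (δ ^ 3 * s) * (δ * (1 - δ / 2))) *
      (Real.exp (δ / 2) - 1 - δ / 2)) ≤ Real.exp m * Real.exp 1 := by
    rw [← Real.exp_add]
    exact Real.exp_le_exp.mpr hexp
  have h3 : ((4 * (2 * m + 1) / (δ ^ 3 * s))⁻¹) ^ m * ((δ / 2)⁻¹) ^ (2 * m + 1) =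
      2 / δ * ((δ * s) ^ m / (2 * m + 1 : ℝ) ^ m) := by
    rw [pow_succ ((δ / 2)⁻¹) (2 * m), pow_mul ((δ / 2)⁻¹) 2 m, ← mul_assoc, ← mul_pow]
    have : (4 * (2 * (m : ℝ) + 1) / (δ ^ 3 * s))⁻¹ * (δ / 2)⁻¹ ^ 2 = δ * s / (2 * m + 1) := by
      field_simp
      ring
    rw [this, div_pow]
    field_simp
  have h4 := two_pow_mul_factorial_mul_exp_le m
  have h5 : Real.exp 2 = Real.exp 1 * Real.exp 1 := by rw [← Real.exp_add]; norm_num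
  have h6 : Real.exp m / (2 * m + 1 : ℝ) ^ m ≤
      Real.exp 1 * (2 * m + 1) / (2 ^ m * m.factorial) := by
    rw [div_le_div_iff₀ (by positivity) (by positivity)]
    calc _ = 2 ^ m * m.factorial * Real.exp m := by ring
      _ ≤ _ := h4
      _ = _ := by ring
  calc _ = (((4 * (2 * m + 1) / (δ ^ 3 * s))⁻¹) ^ m * ((δ / 2)⁻¹) ^ (2 * m + 1)) *
        (2 * m + 1).factorial * Real.exp (s * (4 * (2 * m + 1) / (δ ^ 3 * s) *
          (δ * (1 - δ / 2))) * (Real.exp (δ / 2) - 1 - δ / 2)) := by ring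
    _ ≤ (2 / δ * ((δ * s) ^ m / (2 * m + 1 : ℝ) ^ m)) * (2 * m + 1).factorial *
        (Real.exp m * Real.exp 1) := by rw [h3]; gcongr
    _ = 2 / δ * (δ * s) ^ m * (2 * m + 1).factorial * Real.exp 1 *
        (Real.exp m / (2 * m + 1 : ℝ) ^ m) := by ring
    _ ≤ 2 / δ * (δ * s) ^ m * (2 * m + 1).factorial * Real.exp 1 *
        (Real.exp 1 * (2 * m + 1) / (2 ^ m * m.factorial)) := by gcongr
    _ = _ := by rw [h5, mul_pow]; ring

theorem splitDelta_pos (n : ℕ) (r : Fin n → ℕ) : 0 < splitDelta n r :=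
  Finset.prod_pos fun i _ => by positivity

theorem splitDelta_le_one (n : ℕ) (r : Fin n → ℕ) : splitDelta n r ≤ 1 := by
  refine Finset.prod_le_one (fun i _ => by positivity) fun i _ => ?_
  rw [div_le_one (by positivity)]
  have : 0 < ((i : ℕ) + 1) ^ r i * (r i).factorial := by positivity
  exact_mod_cast this

theorem Yp_eq_centeredInd (n : ℕ) (r : Fin n → ℕ) (p : ℕ) [Fact p.Prime] (a : Fin n → ℤ) :
    Yp n r p a = centeredInd (fun v => SplitTypeOf (vecPoly v) r) (redVec p a) := by
  rw [Yp, centeredInd, HasSplitType, intPoly_map_zmod, Xcard_eq_card_filter]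
  simp

theorem sum_Yp_eq (n : ℕ) (r : Fin n → ℕ) (S : Finset ℕ) [∀ i : S, Fact (i : ℕ).Prime]
    (a : Fin n → ℤ) : ∑ p ∈ S, Yp n r p a =
      ∑ i : S, centeredInd (fun v => SplitTypeOf (vecPoly v) r) (redVec i a) := by
  rw [← Finset.sum_coe_sort]
  exact Finset.sum_congr rfl fun i _ => Yp_eq_centeredInd n r i a

theorem card_coeffBox (n N : ℕ) : ((coeffBox n N).card : ℝ) = (2 * N + 1 : ℝ) ^ n := by
  have h : (coeffBox n N).card = (2 * N + 1) ^ n := by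
    rw [coeffBox, Fintype.card_piFinset]
    simp only [Int.card_Icc, Finset.prod_const, Finset.card_univ, Fintype.card_fin]
    congr 1
    omega
  rw [h]
  push_cast
  rfl

/-- The odd moment over the whole coefficient box. -/
theorem abs_sum_coeffBox_sum_Yp_pow_le {n : ℕ} {r : Fin n → ℕ}
    (hr : ∑ i : Fin n, ((i : ℕ) + 1) * r i = n) (z : ℝ) (hz : 3 ≤ z) (N m : ℕ)
    (hbig : 4 * (2 * m + 1 : ℝ) ≤ splitDelta n r ^ 3 * primePi z) :
    |∑ a ∈ coeffBox n N,
      (∑ p ∈ (range (⌊z⌋₊ + 1)).filter Nat.Prime, Yp n r p a) ^ (2 * m + 1)| ≤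
    (2 * N + 1 : ℝ) ^ n * (2 * Real.exp 2 / splitDelta n r *
      (CkrOdd n r (2 * m + 1) * (primePi z : ℝ) ^ m * (2 * m + 1))) +
    (primePi z : ℝ) ^ (2 * m + 1) *
      ((2 * N + 1 + (⌊z⌋₊ : ℝ) ^ (2 * m + 1)) ^ n - (2 * N + 1 : ℝ) ^ n) := by
  set S := (range (⌊z⌋₊ + 1)).filter Nat.Prime with hS
  have hSp : ∀ i : S, Fact (i : ℕ).Prime := fun i => ⟨(Finset.mem_filter.mp i.2).2⟩
  set δ := splitDelta n r with hδ
  have hδ0 : 0 < δ := splitDelta_pos n r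
  have hδ1 : δ ≤ 1 := splitDelta_le_one n r
  have hcard : (Fintype.card S : ℝ) = primePi z := by rw [Fintype.card_coe]; rfl
  have hpi : (0 : ℝ) < primePi z := by
    by_contra hcon
    have h0 : (primePi z : ℝ) = 0 := le_antisymm (not_lt.mp hcon) (by positivity)
    rw [h0] at hbig
    have : (0 : ℝ) ≤ m := by positivity
    linarith
  have hdens : ∀ i : S, ((univ.filter fun v : Fin n → ZMod i =>
      SplitTypeOf (vecPoly v) r).card : ℝ) / ((i : ℕ) : ℝ) ^ n *
      (1 - ((univ.filter fun v : Fin n → ZMod i =>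
        SplitTypeOf (vecPoly v) r).card : ℝ) / ((i : ℕ) : ℝ) ^ n) ≤ δ * (1 - δ / 2) := by
    intro i
    have h1 := Xcard_div_pow_le_splitDelta (p := i) n r hr
    rw [Xcard_eq_card_filter] at h1
    set d := ((univ.filter fun v : Fin n → ZMod i =>
      SplitTypeOf (vecPoly v) r).card : ℝ) / ((i : ℕ) : ℝ) ^ n with hd
    have h2 : 0 ≤ d := by positivity
    rcases le_total d (δ / 2) with h3 | h3
    · nlinarith
    · nlinarith
  have h4 := abs_sum_coeffBox_centeredInd_pow_le (fun i : S => (i : ℕ)) Subtype.val_injective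
    n N (2 * m + 1) ⌊z⌋₊ (by omega) (Nat.one_le_floor_iff _ |>.mpr (by linarith))
    (fun i => Nat.lt_succ_iff.mp (Finset.mem_range.mp (Finset.mem_filter.mp i.2).1))
    (fun i v => SplitTypeOf (vecPoly v) r) (v := δ * (1 - δ / 2))
    (t := 4 * (2 * m + 1) / (δ ^ 3 * primePi z)) (x := δ / 2)
    (mul_nonneg hδ0.le (by linarith)) (by positivity)
    (div_le_one_of_le₀ hbig (by positivity)) (by positivity) hdens
  simp only [sum_Yp_eq]
  refine h4.trans ?_
  rw [hcard]
  have h5 := odd_moment_bound hδ0 hδ1 hpi m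
  have h6 : (2 * m + 1) / 2 = m := by omega
  have h7 : (2 * m + 1 - 1) / 2 = m := by omega
  rw [h6, CkrOdd, h7, ← hδ]
  gcongr

theorem abs_sum_Yp_le_primePi (n : ℕ) (r : Fin n → ℕ) (z : ℝ) (a : Fin n → ℤ) :
    |∑ p ∈ (range (⌊z⌋₊ + 1)).filter Nat.Prime, Yp n r p a| ≤ primePi z := by
  refine (Finset.abs_sum_le_sum_abs _ _).trans ?_
  refine (Finset.sum_le_card_nsmul _ _ 1 fun p hp => ?_).trans (by simp [primePi])
  have : Fact p.Prime := ⟨(Finset.mem_filter.mp hp).2⟩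
  rw [Yp_eq_centeredInd]
  exact abs_centeredInd_le_one _ _

theorem primePi_le_floor (z : ℝ) : primePi z ≤ ⌊z⌋₊ := by
  have h : (range (⌊z⌋₊ + 1)).filter Nat.Prime ⊆ Finset.Icc 1 ⌊z⌋₊ := by
    intro p hp
    obtain ⟨h1, h2⟩ := Finset.mem_filter.mp hp
    exact Finset.mem_Icc.mpr ⟨h2.one_le, Nat.lt_succ_iff.mp (Finset.mem_range.mp h1)⟩
  simpa [primePi] using Finset.card_le_card h

/-- Passing from the coefficient box to the `S_n`-polynomials when few polynomials are lost. -/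
theorem abs_expN_le {n N : ℕ} {F : (Fin n → ℤ) → ℝ} {B ε : ℝ} (hB : ∀ a, |F a| ≤ B)
    (hε : ε ≤ 1 / 2)
    (hbad : (((coeffBox n N).filter fun a => ¬ IsSnPoly n a).card : ℝ) ≤
      ε * (2 * N + 1 : ℝ) ^ n) :
    |expN n N F| ≤ 2 * (|∑ a ∈ coeffBox n N, F a| / (2 * N + 1 : ℝ) ^ n + ε * B) := by
  set M := (2 * N + 1 : ℝ) ^ n with hM
  have hM0 : 0 < M := by positivity
  have hB0 : 0 ≤ B := (abs_nonneg _).trans (hB 0)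
  have hcard : ((P0 n N).card : ℝ) +
      (((coeffBox n N).filter fun a => ¬ IsSnPoly n a).card : ℝ) = M := by
    rw [hM, ← card_coeffBox, P0]
    exact_mod_cast Finset.card_filter_add_card_filter_not _
  have hhalf : M / 2 ≤ (P0 n N).card := by nlinarith
  have hsum := Finset.sum_filter_add_sum_filter_not (coeffBox n N) (fun a => IsSnPoly n a) F
  have hrest : |∑ a ∈ (coeffBox n N).filter fun a => ¬ IsSnPoly n a, F a| ≤ ε * M * B := by
    refine (Finset.abs_sum_le_sum_abs _ _).trans
      ((Finset.sum_le_card_nsmul _ _ B fun a _ => hB a).trans ?_)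
    rw [nsmul_eq_mul]
    gcongr
  have hP0 : |∑ a ∈ P0 n N, F a| ≤ |∑ a ∈ coeffBox n N, F a| + ε * M * B := by
    have : ∑ a ∈ P0 n N, F a = ∑ a ∈ coeffBox n N, F a -
        ∑ a ∈ (coeffBox n N).filter fun a => ¬ IsSnPoly n a, F a := by
      rw [← hsum, P0]
      ring
    rw [this]
    exact (abs_sub _ _).trans (by gcongr)
  rw [expN, abs_div, Nat.abs_cast]
  calc _ ≤ (|∑ a ∈ coeffBox n N, F a| + ε * M * B) / (M / 2) := by
        gcongr
        exact (abs_nonneg _).trans hP0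
    _ = _ := by field_simp

theorem one_le_CkrOdd_mul {n : ℕ} {r : Fin n → ℕ} {s : ℝ} (hs : 1 ≤ splitDelta n r * s)
    (m : ℕ) : 1 ≤ CkrOdd n r (2 * m + 1) * s ^ m * (2 * m + 1) := by
  have h7 : (2 * m + 1 - 1) / 2 = m := by omega
  have h1 : (2 : ℝ) ^ m * m.factorial ≤ (2 * m + 1).factorial := by
    have h : 2 ^ m * m.factorial ≤ (2 * m + 1).factorial :=
      (Nat.two_pow_mul_factorial_le_factorial_two_mul m).trans
        (Nat.factorial_le (Nat.le_succ _))
    exact_mod_cast h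
  have h2 : (1 : ℝ) ≤ (2 * m + 1).factorial / (2 ^ m * m.factorial) := by
    rwa [one_le_div (by positivity)]
  have h3 : (1 : ℝ) ≤ 2 * m + 1 := by linarith [(Nat.cast_nonneg m : (0 : ℝ) ≤ m)]
  have h4 : 1 ≤ (splitDelta n r * s) ^ m := one_le_pow₀ hs
  rw [CkrOdd, h7]
  calc (1 : ℝ) ≤ (splitDelta n r * s) ^ m * ((2 * m + 1).factorial / (2 ^ m * m.factorial)) *
        (2 * m + 1) := one_le_mul_of_one_le_of_one_le (one_le_mul_of_one_le_of_one_le h4 h2) h3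
    _ = _ := by rw [mul_pow]; ring

/-- The odd moments over the `S_n`-polynomials, once `z` and `N` are large. -/
theorem abs_expN_sum_Yp_pow_le {n : ℕ} {r : Fin n → ℕ} (hn : 2 ≤ n)
    (hr : ∑ i : Fin n, ((i : ℕ) + 1) * r i = n) {z : ℝ} (hz : 3 ≤ z) {N m : ℕ} (hN : 0 < N)
    (hbig : 4 * (2 * m + 1 : ℝ) ≤ splitDelta n r ^ 3 * primePi z) {C : ℝ} (hC : 0 ≤ C)
    (hε : C * (N : ℝ) ^ (-(1 / 16) : ℝ) ≤ 1 / 2)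
    (hbad : (((coeffBox n N).filter fun a => ¬ IsSnPoly n a).card : ℝ) ≤
      C * ((2 * N + 1 : ℝ) ^ n * (N : ℝ) ^ (-(1 / 16) : ℝ)))
    (hzN : z ^ (2 * m + 1) ≤ (N : ℝ) ^ ((1 : ℝ) / 16)) :
    |expN n N (fun f =>
      (∑ p ∈ (range (⌊z⌋₊ + 1)).filter Nat.Prime, Yp n r p f) ^ (2 * m + 1))| ≤
    2 * (2 * Real.exp 2 / splitDelta n r + 2 ^ n + C) *
      (CkrOdd n r (2 * m + 1) * (primePi z : ℝ) ^ m * (2 * m + 1)) := by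
  have hδ0 := splitDelta_pos n r
  have hδ1 := splitDelta_le_one n r
  set A := CkrOdd n r (2 * m + 1) * (primePi z : ℝ) ^ m * (2 * m + 1) with hA
  have hm : (0 : ℝ) ≤ m := Nat.cast_nonneg m
  have hpi0 : (0 : ℝ) ≤ primePi z := Nat.cast_nonneg _
  have hA1 : 1 ≤ A := by
    refine one_le_CkrOdd_mul ?_ m
    have : splitDelta n r ^ 3 ≤ splitDelta n r := pow_le_of_le_one hδ0.le hδ1 (by norm_num)
    nlinarith
  have hN1 : (1 : ℝ) ≤ N := by exact_mod_cast hN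
  have hfl : (⌊z⌋₊ : ℝ) ≤ z := Nat.floor_le (by linarith)
  have hpiz : (primePi z : ℝ) ≤ z := le_trans (by exact_mod_cast primePi_le_floor z) hfl
  set Q := (⌊z⌋₊ : ℝ) ^ (2 * m + 1) with hQ
  set R := (primePi z : ℝ) ^ (2 * m + 1) with hR
  have hQ0 : 0 ≤ Q := by positivity
  have hR0 : 0 ≤ R := by positivity
  have hQN : Q ≤ (N : ℝ) ^ ((1 : ℝ) / 16) :=
    (pow_le_pow_left₀ (by positivity) hfl _).trans hzN
  have hRN : R ≤ (N : ℝ) ^ ((1 : ℝ) / 16) :=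
    (pow_le_pow_left₀ hpi0 hpiz _).trans hzN
  have hRQ : R * Q ≤ N := by
    calc R * Q ≤ (N : ℝ) ^ ((1 : ℝ) / 16) * (N : ℝ) ^ ((1 : ℝ) / 16) := by gcongr
      _ = (N : ℝ) ^ ((1 : ℝ) / 16 + 1 / 16) := (Real.rpow_add (by linarith) _ _).symm
      _ ≤ (N : ℝ) ^ (1 : ℝ) := Real.rpow_le_rpow_of_exponent_le hN1 (by norm_num)
      _ = N := Real.rpow_one _
  have hRε : (N : ℝ) ^ (-(1 / 16) : ℝ) * R ≤ 1 := by
    calc _ ≤ (N : ℝ) ^ (-(1 / 16) : ℝ) * (N : ℝ) ^ ((1 : ℝ) / 16) := by gcongr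
      _ = 1 := by rw [← Real.rpow_add (by linarith)]; norm_num
  have hQM : Q ≤ 2 * N + 1 := by
    have : (N : ℝ) ^ ((1 : ℝ) / 16) ≤ (N : ℝ) ^ (1 : ℝ) :=
      Real.rpow_le_rpow_of_exponent_le hN1 (by norm_num)
    rw [Real.rpow_one] at this
    linarith
  obtain ⟨d, rfl⟩ : ∃ d, n = d + 1 := ⟨n - 1, by omega⟩
  set M := (2 * N + 1 : ℝ) with hM
  have hM0 : 0 < M := by positivity
  have h1 := abs_sum_coeffBox_sum_Yp_pow_le hr z hz N m hbig
  have h2 := add_pow_sub_pow_le hQ0 hQM d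
  have h3 := abs_expN_le (n := d + 1) (N := N) (B := R)
    (F := fun f => (∑ p ∈ (range (⌊z⌋₊ + 1)).filter Nat.Prime, Yp (d + 1) r p f) ^ (2 * m + 1))
    (fun a => by
      rw [abs_pow]
      exact pow_le_pow_left₀ (abs_nonneg _) (abs_sum_Yp_le_primePi _ r z a) _) hε
    (hbad.trans_eq (by ring))
  refine h3.trans ?_
  rw [mul_assoc 2]
  refine mul_le_mul_of_nonneg_left ?_ (by norm_num)
  have h4 : |∑ a ∈ coeffBox (d + 1) N,
      (∑ p ∈ (range (⌊z⌋₊ + 1)).filter Nat.Prime, Yp (d + 1) r p a) ^ (2 * m + 1)| /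
      M ^ (d + 1) ≤ 2 * Real.exp 2 / splitDelta (d + 1) r * A + 2 ^ (d + 1) := by
    rw [div_le_iff₀ (by positivity)]
    calc _ ≤ M ^ (d + 1) * (2 * Real.exp 2 / splitDelta (d + 1) r * A) +
          R * (2 ^ (d + 1) * (Q * M ^ d)) := h1.trans (by gcongr)
      _ = M ^ (d + 1) * (2 * Real.exp 2 / splitDelta (d + 1) r * A) +
          2 ^ (d + 1) * (R * Q * M ^ d) := by ring
      _ ≤ M ^ (d + 1) * (2 * Real.exp 2 / splitDelta (d + 1) r * A) +
          2 ^ (d + 1) * (M * M ^ d) := by gcongr; linarith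
      _ = _ := by ring
  have h5 : C * (N : ℝ) ^ (-(1 / 16) : ℝ) * R ≤ C := by
    rw [mul_assoc]
    exact mul_le_of_le_one_right hC hRε
  have h6 : (2 ^ (d + 1) + C) * 1 ≤ (2 ^ (d + 1) + C) * A :=
    mul_le_mul_of_nonneg_left hA1 (by positivity)
  linarith

theorem log_log_three_pos : 0 < Real.log (Real.log 3) :=
  Real.log_pos ((Real.lt_log_iff_exp_lt (by norm_num)).mpr (Real.exp_one_lt_three))

/-- **Lemma 3.3, odd case**: uniformly for odd `k ≪_{n,r} min(z/(log z·log log z), log N/log z)`,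
`𝔼_N((Σ_{p ≤ z} Y_p(f))^k) ≪_{n,r} C_{k,r}·π(z)^{k/2}·k·(log log z)/π(z)^{1/2} + z^{k(n+1)}/(N·log z)`. -/
theorem moments_Yp_odd (n : ℕ) (hn : 2 ≤ n) (r : Fin n → ℕ)
    (hr : ∑ i : Fin n, ((i : ℕ) + 1) * r i = n) :
    ∃ c > (0 : ℝ), ∃ C > (0 : ℝ), ∀ z : ℝ, 3 ≤ z → ∀ N : ℕ, 2 < N → ∀ k : ℕ, Odd k →
      (k : ℝ) ≤ c * min (z / (Real.log z * Real.log (Real.log z)))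
          (Real.log (N : ℝ) / Real.log z) →
      |expN n N (fun f =>
          (∑ p ∈ (Finset.range (⌊z⌋₊ + 1)).filter Nat.Prime, Yp n r p f) ^ k)| ≤
      C * (CkrOdd n r k * (primePi z : ℝ) ^ ((k : ℝ) / 2) * (k : ℝ) *
            (Real.log (Real.log z) / (primePi z : ℝ) ^ ((1 : ℝ) / 2)) +
          z ^ (k * (n + 1)) / ((N : ℝ) * Real.log z)) := by
  have hδ0 := splitDelta_pos n r
  have hL := log_log_three_pos
  obtain ⟨Cb, hCb, hbad⟩ := exists_card_not_isSnPoly_le hn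
  have hsmall : ∀ᶠ N : ℕ in atTop, Cb * (N : ℝ) ^ (-(1 / 16) : ℝ) ≤ 1 / 2 := by
    have h := ((tendsto_rpow_neg_atTop (y := 1 / 16) (by norm_num)).comp
      tendsto_natCast_atTop_atTop).const_mul Cb
    rw [mul_zero] at h
    exact h.eventually_le_const (by norm_num)
  obtain ⟨N₀, hN₀⟩ := Filter.eventually_atTop.mp (hbad.and hsmall)
  obtain ⟨z₀, hz₀⟩ := Filter.eventually_atTop.mp (eventually_div_log_le_primePi.and
    ((Real.tendsto_log_atTop.comp Real.tendsto_log_atTop).eventually_ge_atTop 1))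
  set c := min (min (1 / 16) (splitDelta n r ^ 3 / 8))
    (min (1 / (N₀ + 1 : ℝ)) (Real.log (Real.log 3) / (2 * (|z₀| + 1)))) with hc
  have hc0 : 0 < c := by
    simp only [hc, lt_min_iff]
    refine ⟨⟨by norm_num, by positivity⟩, by positivity, by positivity⟩
  have hc1 : c ≤ 1 / 16 := (min_le_left _ _).trans (min_le_left _ _)
  have hc2 : c ≤ splitDelta n r ^ 3 / 8 := (min_le_left _ _).trans (min_le_right _ _)
  have hc3 : c ≤ 1 / (N₀ + 1 : ℝ) := (min_le_right _ _).trans (min_le_left _ _)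
  have hc4 : c ≤ Real.log (Real.log 3) / (2 * (|z₀| + 1)) :=
    (min_le_right _ _).trans (min_le_right _ _)
  refine ⟨c, hc0, 2 * (2 * Real.exp 2 / splitDelta n r + 2 ^ n + Cb), by positivity, ?_⟩
  rintro z hz N hN k ⟨m, rfl⟩ hk
  have hk1 : (1 : ℝ) ≤ ((2 * m + 1 : ℕ) : ℝ) := by exact_mod_cast Nat.le_add_left 1 (2 * m)
  have hlog3 : (1 : ℝ) < Real.log 3 :=
    (Real.lt_log_iff_exp_lt (by norm_num)).mpr Real.exp_one_lt_three
  have hlogz : Real.log 3 ≤ Real.log z := Real.log_le_log (by norm_num) hz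
  have hlogz1 : 1 ≤ Real.log z := hlog3.le.trans hlogz
  have hllz : Real.log (Real.log 3) ≤ Real.log (Real.log z) :=
    Real.log_le_log (by linarith) hlogz
  have hkz : ((2 * m + 1 : ℕ) : ℝ) ≤ c * (z / (Real.log z * Real.log (Real.log z))) :=
    hk.trans (mul_le_mul_of_nonneg_left (min_le_left _ _) hc0.le)
  have hkN : ((2 * m + 1 : ℕ) : ℝ) ≤ c * (Real.log N / Real.log z) :=
    hk.trans (mul_le_mul_of_nonneg_left (min_le_right _ _) hc0.le)
  have hN1 : (1 : ℝ) ≤ N := by exact_mod_cast (by omega : 1 ≤ N)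
  have hlogN : 0 ≤ Real.log N := Real.log_nonneg hN1
  have hN₀N : N₀ ≤ N := by
    by_contra hcon
    have h1 : (N : ℝ) ≤ N₀ := by exact_mod_cast (not_le.mp hcon).le
    have h2 : Real.log N / Real.log z ≤ N₀ :=
      (div_le_self hlogN hlogz1).trans (((Real.log_le_self (by linarith)).trans h1))
    have h3 : c * (Real.log N / Real.log z) ≤ 1 / (N₀ + 1 : ℝ) * N₀ := by gcongr
    have h4 : 1 / (N₀ + 1 : ℝ) * N₀ < 1 := by
      rw [one_div_mul_eq_div, div_lt_one (by positivity)]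
      linarith
    linarith
  have hz₀z : z₀ ≤ z := by
    by_contra hcon
    have h1 : z ≤ |z₀| + 1 := by linarith [le_abs_self z₀, not_le.mp hcon]
    have h2 : z / (Real.log z * Real.log (Real.log z)) ≤
        (|z₀| + 1) / (1 * Real.log (Real.log 3)) := by gcongr
    have h3 : c * (z / (Real.log z * Real.log (Real.log z))) ≤
        Real.log (Real.log 3) / (2 * (|z₀| + 1)) *
          ((|z₀| + 1) / (1 * Real.log (Real.log 3))) := by
      gcongr
      exact div_nonneg (by linarith) (mul_nonneg (by linarith) (by linarith))
    have h4 : Real.log (Real.log 3) / (2 * (|z₀| + 1)) *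
          ((|z₀| + 1) / (1 * Real.log (Real.log 3))) = 1 / 2 := by
      field_simp
    linarith
  obtain ⟨hpi, hll⟩ := hz₀ z hz₀z
  replace hll : 1 ≤ Real.log (Real.log z) := hll
  obtain ⟨hbadN, hsmallN⟩ := hN₀ N hN₀N
  have hpi0 : (0 : ℝ) < primePi z :=
    lt_of_lt_of_le (div_pos (by linarith) (by linarith)) hpi
  have hbig : 4 * (2 * m + 1 : ℝ) ≤ splitDelta n r ^ 3 * primePi z := by
    have h1 : z / (Real.log z * Real.log (Real.log z)) ≤ z / (Real.log z * 1) := by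
      gcongr
    have h2 : z / (Real.log z * 1) = 2 * (z / (2 * Real.log z)) := by
      field_simp
    have h3 : ((2 * m + 1 : ℕ) : ℝ) ≤ splitDelta n r ^ 3 / 8 * (2 * primePi z) := by
      refine hkz.trans (mul_le_mul hc2 (by linarith) ?_ (by positivity))
      exact div_nonneg (by linarith) (mul_nonneg (by linarith) (by linarith))
    push_cast at h3
    linarith
  have hzN : z ^ (2 * m + 1) ≤ (N : ℝ) ^ ((1 : ℝ) / 16) := by
    have h1 : ((2 * m + 1 : ℕ) : ℝ) * Real.log z ≤ c * Real.log N := by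
      rwa [← mul_div_assoc, le_div_iff₀ (by linarith)] at hkN
    rw [← Real.log_le_log_iff (by positivity) (by positivity), Real.log_pow,
      Real.log_rpow (by linarith)]
    exact h1.trans (by gcongr)
  have hmain := abs_expN_sum_Yp_pow_le hn hr hz (by omega) hbig hCb.le hsmallN hbadN hzN
  refine hmain.trans (mul_le_mul_of_nonneg_left ?_ (by positivity))
  have hrpow : (primePi z : ℝ) ^ (((2 * m + 1 : ℕ) : ℝ) / 2) =
      (primePi z : ℝ) ^ m * (primePi z : ℝ) ^ ((1 : ℝ) / 2) := by
    rw [← Real.rpow_natCast, ← Real.rpow_add hpi0]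
    congr 1
    push_cast
    ring
  have hCkr : 0 ≤ CkrOdd n r (2 * m + 1) := by
    rw [CkrOdd]
    positivity
  have hsq : (0 : ℝ) < (primePi z : ℝ) ^ ((1 : ℝ) / 2) := by positivity
  have hfirst : CkrOdd n r (2 * m + 1) * (primePi z : ℝ) ^ (((2 * m + 1 : ℕ) : ℝ) / 2) *
      ((2 * m + 1 : ℕ) : ℝ) * (Real.log (Real.log z) / (primePi z : ℝ) ^ ((1 : ℝ) / 2)) =
      CkrOdd n r (2 * m + 1) * (primePi z : ℝ) ^ m * (2 * m + 1) * Real.log (Real.log z) := by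
    rw [hrpow]
    push_cast
    field_simp
  have hsecond : 0 ≤ z ^ ((2 * m + 1) * (n + 1)) / ((N : ℝ) * Real.log z) := by positivity
  rw [hfirst]
  have := le_mul_of_one_le_right
    (by positivity : 0 ≤ CkrOdd n r (2 * m + 1) * (primePi z : ℝ) ^ m * (2 * m + 1)) hll
  linarith

end
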